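/- In the Artin–Schreier–Witt tower setting of length n+1 (with n ≥ 1), let m_n = max_{0≤i≤n−1} p^{n−1−i} ν_i, let μ_n = deg𝔇_{L_n/K} − p^n + 1, and let j be the unique index in {0,…,n−1} with p^{n−1−j} ν_j = m_n (unique because the ν_i are prime to p). Then there exists h ∈ L_n such that v_{L_n}( y_j^{\,p(p^{n−j}−1)+1} − (h^p − h) ) = −( p^{2n−j}·ν_j − μ_n ). -/

import Mathlib

set_option synthInstance.maxHeartbeats 1000000
set_option maxHeartbeats 1600000

/-- The Frobenius on truncated Witt vectors over a ring of characteristic `p`: it raises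
each component to the `p`-th power. -/
noncomputable def twFrobenius (p m : ℕ) {R : Type*} [CommRing R]
    (x : TruncatedWittVector p m R) : TruncatedWittVector p m R :=
  TruncatedWittVector.mk p fun i => x.coeff i ^ p

/-- Componentwise application of a ring homomorphism to a truncated Witt vector. -/
noncomputable def twMap (p m : ℕ) {R S : Type*} [CommRing R] [CommRing S]
    (f : R →+* S) (x : TruncatedWittVector p m R) : TruncatedWittVector p m S :=
  TruncatedWittVector.mk p fun i => f (x.coeff i)

/-- A (rank-one) additive valuation on a field, written additively with value `⊤` at `0`. -/
def IsAddValuation {L : Type*} [Field L] (v : L → WithTop ℤ) : Prop :=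
  (∀ x, v x = ⊤ ↔ x = 0) ∧ (∀ x y, v (x * y) = v x + v y) ∧
    (∀ x y, min (v x) (v y) ≤ v (x + y))

namespace WittVector

variable {p : ℕ} [Fact p.Prime]

theorem ext_ghostComponent_mvPolynomial {σ : Type*} {x y : WittVector p (MvPolynomial σ ℤ)}
    (h : ∀ n, ghostComponent n x = ghostComponent n y) : x = y := by
  have hinj : Function.Injective (MvPolynomial.map (σ := σ) (Int.castRingHom ℚ)) :=
    MvPolynomial.map_injective _ Int.cast_injective
  apply WittVector.map_injective _ hinj
  have : Invertible (p : MvPolynomial σ ℚ) := by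
    have hp : (p : ℚ) ≠ 0 := by exact_mod_cast (Fact.out : p.Prime).ne_zero
    refine ⟨MvPolynomial.C (p : ℚ)⁻¹, ?_, ?_⟩ <;>
    · rw [← map_natCast (MvPolynomial.C (σ := σ) (R := ℚ)) p, ← map_mul]
      simp [hp]
  apply (ghostMap.bijective_of_invertible p (MvPolynomial σ ℚ)).injective
  funext n
  simp only [ghostMap_apply]
  have key : ∀ z : WittVector p (MvPolynomial σ ℤ),
      ghostComponent n (WittVector.map (MvPolynomial.map (Int.castRingHom ℚ)) z) =
        MvPolynomial.map (Int.castRingHom ℚ) (ghostComponent n z) := by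
    intro z
    simp [ghostComponent_apply, aeval_wittPolynomial]
  rw [key, key, h]

theorem teichmuller_mul_coeff {R : Type*} [CommRing R] (a : R) (x : WittVector p R) (n : ℕ) :
    (teichmuller p a * x).coeff n = a ^ p ^ n * x.coeff n := by
  have key : ∀ (b : MvPolynomial R ℤ) (y : WittVector p (MvPolynomial R ℤ)),
      teichmuller p b * y = WittVector.mk p fun i => b ^ p ^ i * y.coeff i := by
    intro b y
    apply ext_ghostComponent_mvPolynomial
    intro m
    rw [map_mul, ghostComponent_teichmuller, ghostComponent_apply, ghostComponent_apply,
      aeval_wittPolynomial, aeval_wittPolynomial, Finset.mul_sum]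
    refine Finset.sum_congr rfl fun i hi => ?_
    rw [coeff_mk, mul_pow, ← pow_mul, ← pow_add,
      Nat.add_sub_cancel' (Finset.mem_range_succ_iff.mp hi)]
    ring
  let π : MvPolynomial R ℤ →+* R := (MvPolynomial.aeval (fun r : R => r)).toRingHom
  have hπ : Function.Surjective π := fun r => ⟨MvPolynomial.X r, by simp [π]⟩
  obtain ⟨b, rfl⟩ := hπ a
  obtain ⟨y, rfl⟩ := WittVector.map_surjective π hπ x
  rw [← map_teichmuller, ← map_mul, key]
  simp

theorem add_coeff_mem {R : Type*} [CommRing R] (S : Subring R) {x y : WittVector p R}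
    (hx : ∀ i, x.coeff i ∈ S) (hy : ∀ i, y.coeff i ∈ S) (n : ℕ) : (x + y).coeff n ∈ S := by
  have lift : ∀ z : WittVector p R, (∀ i, z.coeff i ∈ S) →
      ∃ z' : WittVector p S, WittVector.map S.subtype z' = z := by
    intro z hz
    refine ⟨WittVector.mk p fun i => ⟨z.coeff i, hz i⟩, ?_⟩
    ext i
    simp
  obtain ⟨x', rfl⟩ := lift x hx
  obtain ⟨y', rfl⟩ := lift y hy
  rw [← map_add, map_coeff]
  exact Subtype.property _

theorem coeff_add_of_forall_lt {R : Type*} [CommRing R] {x y : WittVector p R} {n : ℕ}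
    (hx : ∀ i < n, x.coeff i = 0) (hy : ∀ i < n, y.coeff i = 0) :
    (∀ i < n, (x + y).coeff i = 0) ∧ (x + y).coeff n = x.coeff n + y.coeff n := by
  have hxy : x + y = verschiebung^[n] (x.shift n + y.shift n) := by
    rw [iterate_map_add, ← eq_iterate_verschiebung hx, ← eq_iterate_verschiebung hy]
  refine ⟨fun i hi => by rw [hxy, iterate_verschiebung_coeff_eq_zero _ hi], ?_⟩
  have := iterate_verschiebung_coeff (x.shift n + y.shift n) n 0
  rw [zero_add] at this
  rw [hxy, this, add_coeff_zero, shift_coeff, shift_coeff, add_zero]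

omit [Fact p.Prime] in
theorem coeff_init {R : Type*} [CommRing R] (x : WittVector p R) (n i : ℕ) :
    (init n x).coeff i = if i < n then x.coeff i else 0 := by
  rw [init, coeff_select, selectPoly]
  split_ifs <;> simp

omit [Fact p.Prime] in
theorem coeff_tail {R : Type*} [CommRing R] (x : WittVector p R) (n i : ℕ) :
    (tail n x).coeff i = if n ≤ i then x.coeff i else 0 := by
  rw [tail, coeff_select, selectPoly]
  split_ifs <;> simp

theorem add_coeff_eq_init {R : Type*} [CommRing R] (x y : WittVector p R) (n : ℕ) :
    (x + y).coeff n = x.coeff n + y.coeff n + (init n x + init n y).coeff n := by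
  have step : ∀ a b : WittVector p R, (∀ i < n, b.coeff i = 0) →
      (a + b).coeff n = a.coeff n + b.coeff n := by
    intro a b hb
    have h1 := coeff_add_of_forall_lt (x := tail n a) (y := b)
      (fun i hi => by rw [coeff_tail, if_neg (by omega)]) hb
    conv_lhs => rw [← init_add_tail a n, add_assoc]
    rw [coeff_add_of_disjoint, h1.2, coeff_init, coeff_tail, if_neg (by omega),
      if_pos le_rfl, zero_add]
    intro i
    by_cases hi : i < n
    · exact Or.inr (h1.1 i hi)
    · exact Or.inl (by rw [coeff_init, if_neg hi])
  have hxy : x + y = init n x + init n y + (tail n x + tail n y) := by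
    conv_lhs => rw [← init_add_tail x n, ← init_add_tail y n]
    ring
  have ht := coeff_add_of_forall_lt (x := tail n x) (y := tail n y) (n := n)
      (fun i hi => by rw [coeff_tail, if_neg (by omega)])
      (fun i hi => by rw [coeff_tail, if_neg (by omega)])
  rw [hxy, step _ _ ht.1, ht.2, coeff_tail, coeff_tail, if_pos le_rfl, if_pos le_rfl]
  ring

/-- The map `∑ xᵢ ^ (p ^ (n - i) - 1) D xᵢ` induced by a derivation `D`: the `n`-th ghost
component of `D`, divided by `p ^ n`. -/
def ghostDeriv {R : Type*} [CommRing R] (D : R → R) (n : ℕ) (x : WittVector p R) : R :=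
  ∑ i ∈ Finset.range (n + 1), x.coeff i ^ (p ^ (n - i) - 1) * D (x.coeff i)

theorem pow_mul_ghostDeriv {S R : Type*} [CommRing S] [CommRing R] [Algebra S R]
    (D : Derivation S R R) (n : ℕ)
    (x : WittVector p R) : (p : R) ^ n * ghostDeriv D n x = D (ghostComponent n x) := by
  rw [ghostComponent_apply, aeval_wittPolynomial, ghostDeriv, Finset.mul_sum, map_sum]
  refine Finset.sum_congr rfl fun i hi => ?_
  have hi : i ≤ n := Finset.mem_range_succ_iff.mp hi
  have h1 : D ((p : R) ^ i) = 0 := by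
    rw [← Nat.cast_pow]
    exact D.map_natCast _
  rw [Derivation.leibniz, h1, smul_zero, add_zero, Derivation.leibniz_pow]
  simp only [smul_eq_mul, nsmul_eq_mul, Nat.cast_pow]
  conv_lhs => rw [← Nat.add_sub_cancel' hi, pow_add]
  simp only [Nat.add_sub_cancel' hi]
  ring

theorem map_ghostDeriv {R S : Type*} [CommRing R] [CommRing S] (f : R →+* S) {E : R → R}
    {D : S → S} (h : ∀ r, f (E r) = D (f r)) (n : ℕ) (x : WittVector p R) :
    f (ghostDeriv E n x) = ghostDeriv D n (WittVector.map f x) := by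
  simp only [ghostDeriv, map_sum, map_mul, map_pow, map_coeff, h]

theorem ghostDeriv_add {R : Type*} [CommRing R] (D : Derivation ℤ R R) (n : ℕ)
    (x y : WittVector p R) : ghostDeriv D n (x + y) = ghostDeriv D n x + ghostDeriv D n y := by
  let π : MvPolynomial R ℤ →+* R := (MvPolynomial.aeval (fun r : R => r)).toRingHom
  have hπX : ∀ r, π (MvPolynomial.X r) = r := fun r => by simp [π]
  have hπ : Function.Surjective π := fun r => ⟨MvPolynomial.X r, hπX r⟩
  let E := MvPolynomial.mkDerivation ℤ fun r => (MvPolynomial.X (D r) : MvPolynomial R ℤ)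
  have hE : ∀ f, π (E f) = D (π f) := by
    intro f
    induction f using MvPolynomial.induction_on with
    | C a => simp [E]
    | add f g hf hg => simp only [map_add, hf, hg]
    | mul_X f r hf =>
      simp only [Derivation.leibniz, map_add, smul_eq_mul, map_mul, hf, hπX]
      simp [E, MvPolynomial.mkDerivation_X, hπX]
  have hmap := map_ghostDeriv (p := p) π hE n
  obtain ⟨x, rfl⟩ := WittVector.map_surjective π hπ x
  obtain ⟨y, rfl⟩ := WittVector.map_surjective π hπ y
  rw [← map_add, ← hmap, ← hmap, ← hmap, ← map_add]
  congr 1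
  have hp : (p : MvPolynomial R ℤ) ^ n ≠ 0 :=
    pow_ne_zero _ (by exact_mod_cast (Fact.out : p.Prime).ne_zero)
  apply mul_left_cancel₀ hp
  rw [mul_add, pow_mul_ghostDeriv, pow_mul_ghostDeriv, pow_mul_ghostDeriv, map_add, map_add]

theorem ghostDeriv_frobenius {R : Type*} [CommRing R] [CharP R p] (D : Derivation ℤ R R) (n : ℕ)
    (x : WittVector p R) : ghostDeriv D n (frobenius x) = 0 := by
  refine Finset.sum_eq_zero fun i _ => ?_
  rw [coeff_frobenius_charP, Derivation.leibniz_pow, nsmul_eq_mul, CharP.cast_eq_zero, zero_mul,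
    mul_zero]

end WittVector

theorem Derivation.exists_extension_of_formallyEtale {S T : Type*} [CommRing S] [CommRing T]
    [Algebra S T] [Algebra.FormallyEtale S T] (D : Derivation ℤ S S) :
    ∃ D' : Derivation ℤ T T, ∀ s, D' (algebraMap S T s) = algebraMap S T (D s) := by
  let e := KaehlerDifferential.tensorKaehlerEquivOfFormallyEtale ℤ S T
  let g : KaehlerDifferential ℤ S →ₗ[S] T :=
    (Algebra.linearMap S T).comp D.liftKaehlerDifferential
  refine ⟨((LinearMap.liftBaseChange T g).comp e.symm.toLinearMap).compDer
    (KaehlerDifferential.D ℤ T), fun s => ?_⟩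
  change (LinearMap.liftBaseChange T g) (e.symm (KaehlerDifferential.D ℤ T (algebraMap S T s))) = _
  rw [KaehlerDifferential.tensorKaehlerEquivOfFormallyEtale_symm_D_algebraMap]
  simp [g]

namespace AddValuation

variable {L : Type*} [Field L] (w : AddValuation L (WithTop ℤ))

theorem exists_eq_coe {x : L} (hx : x ≠ 0) : ∃ a : ℤ, w x = a := by
  obtain ⟨a, ha⟩ := WithTop.ne_top_iff_exists.mp ((w.ne_top_iff).mpr hx)
  exact ⟨a, ha.symm⟩

theorem coe_le_mul {x y : L} {a b : ℤ} (hx : (a : WithTop ℤ) ≤ w x) (hy : (b : WithTop ℤ) ≤ w y) :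
    ((a + b : ℤ) : WithTop ℤ) ≤ w (x * y) := by
  rw [w.map_mul, WithTop.coe_add]
  exact add_le_add hx hy

theorem coe_le_pow {x : L} {a : ℤ} (hx : (a : WithTop ℤ) ≤ w x) (k : ℕ) :
    ((k * a : ℤ) : WithTop ℤ) ≤ w (x ^ k) := by
  induction k with
  | zero => simp
  | succ k ih =>
    rw [pow_succ]
    convert w.coe_le_mul ih hx using 2
    push_cast; ring

theorem pow_eq_coe {x : L} {a : ℤ} (hx : w x = (a : WithTop ℤ)) (k : ℕ) :
    w (x ^ k) = ((k * a : ℤ) : WithTop ℤ) := by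
  induction k with
  | zero => simp
  | succ k ih =>
    rw [pow_succ, w.map_mul, ih, hx, ← WithTop.coe_add]
    congr 1
    push_cast; ring

theorem zpow_eq_coe {x : L} {a : ℤ} (hx : w x = (a : WithTop ℤ)) (k : ℤ) :
    w (x ^ k) = ((k * a : ℤ) : WithTop ℤ) := by
  have hx0 : x ≠ 0 := by
    rintro rfl
    simp at hx
  obtain ⟨m, rfl | rfl⟩ := k.eq_nat_or_neg
  · exact_mod_cast w.pow_eq_coe hx m
  · obtain ⟨b, hb⟩ := w.exists_eq_coe (zpow_ne_zero (-(m : ℤ)) hx0)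
    have h1 : w (x ^ (-(m : ℤ)) * x ^ m) = 0 := by
      rw [zpow_neg, zpow_natCast, inv_mul_cancel₀ (pow_ne_zero _ hx0), w.map_one]
    rw [w.map_mul, hb, w.pow_eq_coe hx, ← WithTop.coe_add] at h1
    rw [hb]
    congr 1
    have : b + m * a = 0 := by exact_mod_cast h1
    linarith

/-- The valuation ring of an additive valuation, as a subring. -/
def nonnegSubring : Subring L where
  carrier := {z | 0 ≤ w z}
  mul_mem' {a b} ha hb := by
    simp only [Set.mem_ofPred_eq, w.map_mul] at *
    exact add_nonneg ha hb
  one_mem' := by simp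
  add_mem' ha hb := w.map_le_add ha hb
  zero_mem' := by simp
  neg_mem' {a} ha := by simpa using ha

theorem neg_le_of_pow_eq_add {p : ℕ} (hp : 2 ≤ p) {x b : L} (h : x ^ p = x + b) {c : ℤ}
    (hc : 0 ≤ c) (hb : ((-(p * c) : ℤ) : WithTop ℤ) ≤ w b) : ((-c : ℤ) : WithTop ℤ) ≤ w x := by
  by_cases hx : x = 0
  · simp [hx]
  obtain ⟨a, ha⟩ := w.exists_eq_coe hx
  rw [ha]
  by_contra hlt
  have hlt : a < -c := by
    have := not_le.mp hlt
    exact_mod_cast this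
  have h1 : ((a + (p - 1) * a + 1 : ℤ) : WithTop ℤ) ≤ w (x + b) := by
    have hp' : (2 : ℤ) ≤ p := by exact_mod_cast hp
    refine w.map_le_add ?_ (le_trans ?_ hb)
    · rw [ha]
      have : a + (p - 1) * a + 1 ≤ a := by nlinarith
      exact_mod_cast this
    · have : a + (p - 1) * a + 1 ≤ -(p * c) := by nlinarith
      exact_mod_cast this
  rw [← h, w.pow_eq_coe ha] at h1
  have : a + (p - 1) * a + 1 ≤ p * a := by exact_mod_cast h1
  linarith

theorem eq_of_pow_eq_add {p : ℕ} (hp : 2 ≤ p) {x b : L} (h : x ^ p = x + b) {c : ℤ}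
    (hc : 0 < c) (hb : w b = ((-(p * c) : ℤ) : WithTop ℤ)) : w x = ((-c : ℤ) : WithTop ℤ) := by
  have h1 := w.neg_le_of_pow_eq_add hp h hc.le hb.ge
  have hp' : (2 : ℤ) ≤ p := by exact_mod_cast hp
  have hx : x ≠ 0 := by
    rintro rfl
    rw [zero_pow (by omega), zero_add] at h
    rw [← h, w.map_zero] at hb
    exact WithTop.top_ne_coe hb
  obtain ⟨a, ha⟩ := w.exists_eq_coe hx
  have hca : -c ≤ a := by rw [ha] at h1; exact_mod_cast h1
  have h2 : w (x + b) = w b := by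
    refine w.map_add_eq_of_lt_right ?_
    rw [ha, hb]
    have : -(p * c) < a := by nlinarith
    exact_mod_cast this
  rw [← h, w.pow_eq_coe ha, hb] at h2
  have h3 : (p : ℤ) * a = -(p * c) := by exact_mod_cast h2
  have h4 : (p : ℤ) * (a + c) = 0 := by linarith
  have h5 : a + c = 0 := (mul_eq_zero.mp h4).resolve_left (by omega)
  rw [ha]
  congr 1
  linarith

end AddValuation

namespace WittVector

variable {p : ℕ} [Fact p.Prime] {L : Type*} [Field L] (w : AddValuation L (WithTop ℤ))

theorem le_addValuation_add_coeff {t : L} (ht : w t = 1) (c : ℕ) {x y : WittVector p L}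
    (hx : ∀ i, ((-(p ^ i * c) : ℤ) : WithTop ℤ) ≤ w (x.coeff i))
    (hy : ∀ i, ((-(p ^ i * c) : ℤ) : WithTop ℤ) ≤ w (y.coeff i)) (n : ℕ) :
    ((-(p ^ n * c) : ℤ) : WithTop ℤ) ≤ w ((x + y).coeff n) := by
  have ht' : w t = ((1 : ℤ) : WithTop ℤ) := ht
  have hpow : ∀ i : ℕ, w ((t ^ c) ^ p ^ i) = ((p ^ i * c : ℤ) : WithTop ℤ) := by
    intro i
    rw [← pow_mul, w.pow_eq_coe ht']
    congr 1
    push_cast; ring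
  have hmem : ∀ z : WittVector p L, (∀ i, ((-(p ^ i * c) : ℤ) : WithTop ℤ) ≤ w (z.coeff i)) →
      ∀ i, (teichmuller p (t ^ c) * z).coeff i ∈ w.nonnegSubring := by
    intro z hz i
    rw [teichmuller_mul_coeff]
    have := w.coe_le_mul (hpow i).ge (hz i)
    rwa [add_neg_cancel] at this
  have h := add_coeff_mem w.nonnegSubring (hmem x hx) (hmem y hy) n
  rw [← mul_add, teichmuller_mul_coeff] at h
  have h' : (0 : WithTop ℤ) ≤ w _ := h
  by_cases h0 : (x + y).coeff n = 0
  · simp [h0]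
  obtain ⟨a, ha⟩ := w.exists_eq_coe h0
  rw [w.map_mul, hpow, ha, ← WithTop.coe_add] at h'
  rw [ha]
  have : (0 : ℤ) ≤ p ^ n * c + a := by exact_mod_cast h'
  exact_mod_cast (by linarith : -(p ^ n * c : ℤ) ≤ a)

theorem le_addValuation_init_add_init_coeff {t : L} (ht : w t = 1) (c : ℕ) {x y : WittVector p L}
    {l : ℕ} (hx : ∀ i < l, ((-(p ^ i * c) : ℤ) : WithTop ℤ) ≤ w (x.coeff i))
    (hy : ∀ i < l, ((-(p ^ i * c) : ℤ) : WithTop ℤ) ≤ w (y.coeff i)) (n : ℕ) :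
    ((-(p ^ n * c) : ℤ) : WithTop ℤ) ≤ w ((init l x + init l y).coeff n) := by
  refine le_addValuation_add_coeff w ht c (fun i => ?_) (fun i => ?_) n
  · rw [coeff_init]
    split_ifs with h
    · exact hx i h
    · simp
  · rw [coeff_init]
    split_ifs with h
    · exact hy i h
    · simp

variable [CharP L p] {x u : WittVector p L} (hF : frobenius x = x + u)
include hF

theorem coeff_pow_eq_of_frobenius_eq_add (l : ℕ) :
    x.coeff l ^ p = x.coeff l + (u.coeff l + (init l x + init l u).coeff l) := by
  rw [← coeff_frobenius_charP, hF, add_coeff_eq_init, add_assoc]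

theorem le_addValuation_coeff_of_frobenius_eq_add {t : L} (ht : w t = 1) (b : ℕ) {N : ℕ}
    (hu : ∀ l < N, ((-(p ^ (l + 1) * b) : ℤ) : WithTop ℤ) ≤ w (u.coeff l)) :
    ∀ l < N, ((-(p ^ l * b) : ℤ) : WithTop ℤ) ≤ w (x.coeff l) := by
  intro l
  induction l using Nat.strong_induction_on with
  | _ l ih =>
    intro hl
    have hp := (Fact.out : p.Prime).two_le
    refine w.neg_le_of_pow_eq_add hp (coeff_pow_eq_of_frobenius_eq_add hF l) (by positivity) ?_
    have hpl : (p * (p ^ l * b) : ℤ) = p ^ (l + 1) * b := by ring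
    rw [hpl]
    refine w.map_le_add (hu l hl) ?_
    have := le_addValuation_init_add_init_coeff w ht (p * b) (x := x) (y := u) (l := l) ?_ ?_ l
    · convert this using 2
      push_cast; ring
    · intro i hi
      refine le_trans ?_ (ih i hi (hi.trans hl))
      have : -(p ^ i * (p * b : ℕ) : ℤ) ≤ -(p ^ i * b) := by
        have h1 : b ≤ p * b := Nat.le_mul_of_pos_left b (by omega)
        have h2 := Nat.mul_le_mul_left (p ^ i) h1
        have h3 : (p ^ i * b : ℤ) ≤ p ^ i * (p * b : ℕ) := by exact_mod_cast h2
        linarith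
      exact_mod_cast this
    · intro i hi
      refine le_trans (le_of_eq ?_) (hu i (hi.trans hl))
      congr 1
      push_cast; ring

theorem addValuation_coeff_of_frobenius_eq_add {t : L} (ht : w t = 1) {b m : ℕ} (hbm : b < m)
    {N : ℕ} (hu : ∀ l < N, ((-(p ^ (l + 1) * b) : ℤ) : WithTop ℤ) ≤ w (u.coeff l))
    (huN : w (u.coeff N) = ((-(p ^ (N + 1) * m) : ℤ) : WithTop ℤ)) :
    w (x.coeff N) = ((-(p ^ N * m) : ℤ) : WithTop ℤ) := by
  have hp := (Fact.out : p.Prime).two_le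
  have hx := le_addValuation_coeff_of_frobenius_eq_add w hF ht b hu
  have hlt : (-(p ^ (N + 1) * m) : ℤ) < -(p ^ (N + 1) * b) := by
    have : (p ^ (N + 1) * b : ℤ) < p ^ (N + 1) * m := by
      have := Nat.mul_lt_mul_of_pos_left hbm (show 0 < p ^ (N + 1) by positivity)
      exact_mod_cast this
    linarith
  have hpos : (0 : ℤ) < p ^ N * m := by
    have : 0 < p ^ N * m := Nat.mul_pos (by positivity) (by omega)
    exact_mod_cast this
  refine w.eq_of_pow_eq_add hp (coeff_pow_eq_of_frobenius_eq_add hF N) hpos ?_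
  rw [w.map_add_eq_of_lt_left, huN]
  · congr 1; ring
  · rw [huN]
    have h := le_addValuation_init_add_init_coeff w ht (p * b) (x := x) (y := u) (l := N) ?_ ?_ N
    · refine lt_of_lt_of_le ?_ h
      have : (-(p ^ (N + 1) * m) : ℤ) < -(p ^ N * (p * b : ℕ)) := by
        push_cast
        rw [pow_succ] at hlt ⊢
        linarith
      exact_mod_cast this
    · intro i hi
      refine le_trans ?_ (hx i hi)
      have : -(p ^ i * (p * b : ℕ) : ℤ) ≤ -(p ^ i * b) := by
        have h1 : b ≤ p * b := Nat.le_mul_of_pos_left b (by omega)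
        have h2 := Nat.mul_le_mul_left (p ^ i) h1
        have h3 : (p ^ i * b : ℤ) ≤ p ^ i * (p * b : ℕ) := by exact_mod_cast h2
        linarith
      exact_mod_cast this
    · intro i hi
      refine le_trans (le_of_eq ?_) (hu i hi)
      congr 1
      push_cast; ring

theorem deriv_coeff_of_frobenius_eq_add (D : Derivation ℤ L L) (l : ℕ) :
    D (x.coeff l) = -(∑ i ∈ Finset.range l, x.coeff i ^ (p ^ (l - i) - 1) * D (x.coeff i) +
      ∑ i ∈ Finset.range l, u.coeff i ^ (p ^ (l - i) - 1) * D (u.coeff i)) - D (u.coeff l) := by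
  have h := ghostDeriv_add D l x u
  rw [← hF, ghostDeriv_frobenius, ghostDeriv, ghostDeriv, Finset.sum_range_succ,
    Finset.sum_range_succ, Nat.sub_self, pow_zero, Nat.sub_self, pow_zero, pow_zero, one_mul,
    one_mul] at h
  linear_combination -h

omit hF [CharP L p] in
theorem le_addValuation_deriv_aux (D : Derivation ℤ L L) {b q l : ℕ}
    (hu : ∀ i < l, ((-(p ^ (i + 1) * b) : ℤ) : WithTop ℤ) ≤ w (u.coeff i))
    (hx : ∀ i < l, ((-(p ^ i * b) : ℤ) : WithTop ℤ) ≤ w (x.coeff i))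
    (hDu : ∀ i < l, ((-(p ^ (i + 1) * b + q) : ℤ) : WithTop ℤ) ≤ w (D (u.coeff i)))
    (hDx : ∀ i < l, ((-(p ^ (i + 1) * b + q) : ℤ) : WithTop ℤ) ≤ w (D (x.coeff i))) :
    ((-(p ^ (l + 1) * b + q) : ℤ) : WithTop ℤ) ≤
      w (-(∑ i ∈ Finset.range l, x.coeff i ^ (p ^ (l - i) - 1) * D (x.coeff i) +
      ∑ i ∈ Finset.range l, u.coeff i ^ (p ^ (l - i) - 1) * D (u.coeff i))) := by
  have hp := (Fact.out : p.Prime).two_le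
  have hp1 : (2 : ℤ) ≤ p := by exact_mod_cast hp
  rw [w.map_neg]
  have hcast : ∀ i, ((p ^ (l - i) - 1 : ℕ) : ℤ) = p ^ (l - i) - 1 := by
    intro i
    rw [Nat.cast_sub (Nat.one_le_pow _ _ (by omega))]
    simp
  refine w.map_le_add (w.map_le_sum fun i hi => ?_) (w.map_le_sum fun i hi => ?_)
  · have hi := Finset.mem_range.mp hi
    refine le_trans ?_ (w.coe_le_mul (w.coe_le_pow (hx i hi) _) (hDx i hi))
    rw [hcast]
    have h1 : (p : ℤ) ^ i * p ^ (l - i) = p ^ l := by rw [← pow_add, Nat.add_sub_cancel' hi.le]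
    have h2 : (p : ℤ) ^ (i + 1) ≤ p ^ l := pow_le_pow_right₀ (by linarith) hi
    have h3 : (0 : ℤ) < p ^ i := by positivity
    have h4 : (p : ℤ) ^ l + p ^ (i + 1) - p ^ i ≤ p ^ (l + 1) := by
      have h5 : (p : ℤ) ^ (l + 1) = p * p ^ l := by ring
      have h6 : 2 * (p : ℤ) ^ l ≤ p * p ^ l := mul_le_mul_of_nonneg_right hp1 (by positivity)
      linarith
    have h5 := mul_le_mul_of_nonneg_right h4 (Int.natCast_nonneg b)
    have h6 : ((p : ℤ) ^ (l - i) - 1) * -(p ^ i * b) + -(p ^ (i + 1) * b + q) =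
        -((p ^ l + p ^ (i + 1) - p ^ i) * b + q) := by
      rw [← h1]; ring
    rw [h6]
    exact WithTop.coe_le_coe.mpr (by linarith)
  · have hi := Finset.mem_range.mp hi
    refine le_trans ?_ (w.coe_le_mul (w.coe_le_pow (hu i hi) _) (hDu i hi))
    rw [hcast]
    have h1 : (p : ℤ) ^ (i + 1) * p ^ (l - i) = p ^ (l + 1) := by
      rw [← pow_add]; congr 1; omega
    refine le_of_eq ?_
    congr 1
    rw [← h1]; ring

theorem le_addValuation_deriv_coeff (D : Derivation ℤ L L) {t : L} (ht : w t = 1) {b q N : ℕ}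
    (hu : ∀ i < N, ((-(p ^ (i + 1) * b) : ℤ) : WithTop ℤ) ≤ w (u.coeff i))
    (hDu : ∀ i < N, ((-(p ^ (i + 1) * b + q) : ℤ) : WithTop ℤ) ≤ w (D (u.coeff i))) :
    ∀ l < N, ((-(p ^ (l + 1) * b + q) : ℤ) : WithTop ℤ) ≤ w (D (x.coeff l)) := by
  intro l
  have hx := le_addValuation_coeff_of_frobenius_eq_add w hF ht b hu
  induction l using Nat.strong_induction_on with
  | _ l ih =>
    intro hl
    rw [deriv_coeff_of_frobenius_eq_add hF]
    exact w.map_le_sub (le_addValuation_deriv_aux w D (fun i hi => hu i (hi.trans hl))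
      (fun i hi => hx i (hi.trans hl)) (fun i hi => hDu i (hi.trans hl))
      (fun i hi => ih i hi (hi.trans hl))) (hDu l hl)

theorem addValuation_deriv_coeff (D : Derivation ℤ L L) {t : L} (ht : w t = 1) {b m q N : ℕ}
    (hbm : b < m)
    (hu : ∀ i < N, ((-(p ^ (i + 1) * b) : ℤ) : WithTop ℤ) ≤ w (u.coeff i))
    (hDu : ∀ i < N, ((-(p ^ (i + 1) * b + q) : ℤ) : WithTop ℤ) ≤ w (D (u.coeff i)))
    (hDuN : w (D (u.coeff N)) = ((-(p ^ (N + 1) * m + q) : ℤ) : WithTop ℤ)) :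
    w (D (x.coeff N)) = ((-(p ^ (N + 1) * m + q) : ℤ) : WithTop ℤ) := by
  have hx := le_addValuation_coeff_of_frobenius_eq_add w hF ht b hu
  have hDx := le_addValuation_deriv_coeff w hF D ht hu hDu
  rw [deriv_coeff_of_frobenius_eq_add hF, w.map_sub_eq_of_lt_right, hDuN]
  rw [hDuN]
  refine lt_of_lt_of_le ?_ (le_addValuation_deriv_aux w D hu hx hDu hDx)
  have : (p ^ (N + 1) * b : ℤ) < p ^ (N + 1) * m := by
    have hp := (Fact.out : p.Prime).pos
    have := Nat.mul_lt_mul_of_pos_left hbm (show 0 < p ^ (N + 1) by positivity)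
    exact_mod_cast this
  exact_mod_cast (by linarith : (-(p ^ (N + 1) * m + q) : ℤ) < -(p ^ (N + 1) * b + q))

end WittVector

section TraceTower

universe u

open Polynomial IntermediateField

theorem PowerBasis.trace_gen_pow_div_aeval_derivative {K L : Type*} [Field K] [Field L]
    [Algebra K L] [FiniteDimensional K L] [Algebra.IsSeparable K L] (pb : PowerBasis K L)
    {i : ℕ} (hi : i < pb.dim) :
    Algebra.trace K L (pb.gen ^ i / aeval pb.gen (derivative (minpoly K pb.gen))) =
      if i + 1 = pb.dim then 1 else 0 := by
  have h_int := pb.isIntegral_gen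
  have hdeg := natDegree_minpolyDiv_succ h_int
  rw [pb.natDegree_minpoly] at hdeg
  have h1 := pb.basis.trace_traceDual_mul ⟨pb.dim - 1, by omega⟩ ⟨i, hi⟩
  rw [Module.Basis.traceDual_powerBasis_eq, PowerBasis.coe_basis] at h1
  have h2 : (minpolyDiv K pb.gen).coeff (pb.dim - 1) = 1 := by
    rw [← hdeg, Nat.add_sub_cancel]
    exact minpolyDiv_monic h_int
  simp only [h2, Fin.mk.injEq] at h1
  rw [div_eq_inv_mul, ← one_div, h1]
  exact if_congr (by omega) rfl rfl

variable {p : ℕ} [Fact p.Prime]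

theorem natDegree_minpoly_le_of_pow_sub_self_mem {F L : Type*} [Field F] [Field L] [Algebra F L]
    {x : L} {c : F} (h : x ^ p - x = algebraMap F L c) :
    IsIntegral F x ∧ (minpoly F x).natDegree ≤ p := by
  have hp := (Fact.out : p.Prime).one_lt
  have hdeg : (X + C c : F[X]).degree < p := by
    rw [degree_X_add_C]
    exact_mod_cast hp
  have hm : (X ^ p - (X + C c) : F[X]).Monic := monic_X_pow_sub (by rwa [degree_X_add_C] at *)
  have hr : aeval x (X ^ p - (X + C c) : F[X]) = 0 := by
    simp [← h]
  refine ⟨⟨_, hm, hr⟩, ?_⟩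
  refine (natDegree_le_of_dvd (minpoly.dvd F x hr) hm.ne_zero).trans (le_of_eq ?_)
  rw [natDegree_sub_eq_left_of_natDegree_lt, natDegree_X_pow]
  rwa [natDegree_X_pow, natDegree_X_add_C]

theorem minpoly_eq_of_pow_sub_self_mem {F L : Type*} [Field F] [Field L] [Algebra F L]
    {x : L} {c : F} (h : x ^ p - x = algebraMap F L c) (hdeg : (minpoly F x).natDegree = p) :
    minpoly F x = X ^ p - (X + C c) := by
  have hp := (Fact.out : p.Prime).one_lt
  have hm : (X ^ p - (X + C c) : F[X]).Monic := monic_X_pow_sub (by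
    rw [degree_X_add_C]
    exact_mod_cast hp)
  have hr : aeval x (X ^ p - (X + C c) : F[X]) = 0 := by
    simp [← h]
  refine (minpoly.unique_of_degree_le_degree_minpoly F x hm hr ?_).symm
  rw [degree_eq_natDegree (minpoly.ne_zero ⟨_, hm, hr⟩), hdeg]
  refine degree_sub_le_of_le ?_ ?_ |>.trans (max_self _).le
  · exact (degree_X_pow_le _)
  · rw [degree_X_add_C]
    exact_mod_cast hp.le

theorem adjoin_image_Iio_succ_le {F L : Type*} [Field F] [Field L] [Algebra F L] (x : ℕ → L)
    (l : ℕ) : adjoin F (x '' Set.Iio (l + 1)) ≤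
      (adjoin F⟮x 0⟯ ((fun i => x (i + 1)) '' Set.Iio l)).restrictScalars F := by
  rw [adjoin_le_iff]
  rintro _ ⟨i, hi, rfl⟩
  rcases i with _ | i
  · rw [SetLike.mem_coe, mem_restrictScalars]
    exact IntermediateField.algebraMap_mem _ (AdjoinSimple.gen F (x 0))
  · rw [SetLike.mem_coe, mem_restrictScalars]
    refine subset_adjoin _ _ ⟨i, ?_, rfl⟩
    simpa using hi

theorem finrank_le_of_artinSchreier_tower {L : Type u} [Field L] (m : ℕ) :
    ∀ (F : Type u) [Field F] [Algebra F L] [FiniteDimensional F L] (x : ℕ → L),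
    (∀ l < m, x l ^ p - x l ∈ adjoin F (x '' Set.Iio l)) → adjoin F (x '' Set.Iio m) = ⊤ →
    Module.finrank F L ≤ p ^ m := by
  induction m with
  | zero =>
    intro F _ _ _ x hx htop
    have : (⊥ : IntermediateField F L) = ⊤ := by
      rw [← htop]
      simp
    rw [pow_zero, ← IntermediateField.finrank_top', ← this, IntermediateField.finrank_bot]
  | succ m ih =>
    intro F _ _ _ x hx htop
    have h0 := hx 0 (Nat.succ_pos m)
    have : x '' Set.Iio 0 = ∅ := by simp
    rw [this, adjoin_empty, IntermediateField.mem_bot] at h0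
    obtain ⟨c, hc⟩ := h0
    obtain ⟨h_int, hdeg⟩ := natDegree_minpoly_le_of_pow_sub_self_mem (p := p) hc.symm
    rw [← adjoin.finrank h_int] at hdeg
    have hx' : ∀ l < m, x (l + 1) ^ p - x (l + 1) ∈
        adjoin F⟮x 0⟯ ((fun i => x (i + 1)) '' Set.Iio l) :=
      fun l hl => adjoin_image_Iio_succ_le x l (hx (l + 1) (Nat.succ_lt_succ hl))
    have htop' : adjoin F⟮x 0⟯ ((fun i => x (i + 1)) '' Set.Iio m) = ⊤ := by
      rw [eq_top_iff]
      intro z _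
      exact adjoin_image_Iio_succ_le x m (htop ▸ mem_top)
    have h1 := ih F⟮x 0⟯ (fun i => x (i + 1)) hx' htop'
    rw [← Module.finrank_mul_finrank F F⟮x 0⟯ L, pow_succ']
    exact Nat.mul_le_mul hdeg h1

theorem trace_prod_pow_of_artinSchreier_tower_aux {L : Type u} [Field L] [CharP L p] (m : ℕ) :
    ∀ (F : Type u) [Field F] [Algebra F L] [FiniteDimensional F L] [Algebra.IsSeparable F L]
    (x : ℕ → L),
    (∀ l < m, x l ^ p - x l ∈ adjoin F (x '' Set.Iio l)) → adjoin F (x '' Set.Iio m) = ⊤ →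
    Module.finrank F L = p ^ m →
    Algebra.trace F L (∏ l ∈ Finset.range m, x l ^ (p - 1)) = (-1) ^ m := by
  have hp := (Fact.out : p.Prime)
  induction m with
  | zero =>
    intro F _ _ _ _ x hx htop hfr
    rw [Finset.prod_range_zero, ← map_one (algebraMap F L), Algebra.trace_algebraMap, hfr]
    simp
  | succ m ih =>
    intro F _ _ _ _ x hx htop hfr
    have : CharP F p := (algebraMap F L).charP (algebraMap F L).injective p
    have h0 := hx 0 (Nat.succ_pos m)
    have : x '' Set.Iio 0 = ∅ := by simp
    rw [this, adjoin_empty, IntermediateField.mem_bot] at h0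
    obtain ⟨c, hc⟩ := h0
    obtain ⟨h_int, hdeg⟩ := natDegree_minpoly_le_of_pow_sub_self_mem (p := p) hc.symm
    have hx' : ∀ l < m, x (l + 1) ^ p - x (l + 1) ∈
        adjoin F⟮x 0⟯ ((fun i => x (i + 1)) '' Set.Iio l) :=
      fun l hl => adjoin_image_Iio_succ_le x l (hx (l + 1) (Nat.succ_lt_succ hl))
    have htop' : adjoin F⟮x 0⟯ ((fun i => x (i + 1)) '' Set.Iio m) = ⊤ := by
      rw [eq_top_iff]
      intro z _
      exact adjoin_image_Iio_succ_le x m (htop ▸ mem_top)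
    have h1 := finrank_le_of_artinSchreier_tower m F⟮x 0⟯ (fun i => x (i + 1)) hx' htop'
    have h2 := Module.finrank_mul_finrank F F⟮x 0⟯ L
    rw [adjoin.finrank h_int, hfr, pow_succ'] at h2
    have hpos : 0 < p ^ m := pow_pos hp.pos m
    have hdeg' : (minpoly F (x 0)).natDegree = p := by
      refine le_antisymm hdeg ?_
      by_contra hlt
      rw [not_le] at hlt
      have := Nat.mul_lt_mul_of_lt_of_le hlt h1 hpos
      omega
    have hfr' : Module.finrank F⟮x 0⟯ L = p ^ m := by
      rw [hdeg'] at h2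
      exact Nat.eq_of_mul_eq_mul_left hp.pos h2
    have h3 := ih F⟮x 0⟯ (fun i => x (i + 1)) hx' htop' hfr'
    have hmin := minpoly_eq_of_pow_sub_self_mem hc.symm hdeg'
    have h4 := (adjoin.powerBasis h_int).trace_gen_pow_div_aeval_derivative (i := p - 1) (by
      rw [adjoin.powerBasis_dim, hdeg']
      have := hp.pos
      omega)
    rw [adjoin.powerBasis_dim, hdeg', if_pos (Nat.sub_add_cancel hp.pos),
      adjoin.powerBasis_gen, minpoly_gen, hmin] at h4
    have h5 : aeval (AdjoinSimple.gen F (x 0)) (derivative (X ^ p - (X + C c) : F[X])) = -1 := by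
      rw [derivative_sub, derivative_X_pow, CharP.cast_eq_zero F p]
      simp
    rw [h5, div_neg, div_one, map_neg] at h4
    have h6 : ∏ l ∈ Finset.range (m + 1), x l ^ (p - 1) =
        (AdjoinSimple.gen F (x 0) ^ (p - 1)) • ∏ l ∈ Finset.range m, x (l + 1) ^ (p - 1) := by
      rw [Finset.prod_range_succ', mul_comm, Algebra.smul_def, map_pow,
        AdjoinSimple.algebraMap_gen]
    rw [h6, ← Algebra.trace_trace (S := F⟮x 0⟯), map_smul, h3, smul_eq_mul]
    have h7 : (AdjoinSimple.gen F (x 0) ^ (p - 1)) * (-1) ^ m =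
        ((-1 : F) ^ m) • (AdjoinSimple.gen F (x 0) ^ (p - 1)) := by
      rw [Algebra.smul_def, mul_comm]
      simp
    rw [h7, map_smul, smul_eq_mul, pow_succ, ← h4]
    ring

theorem trace_prod_pow_of_artinSchreier_tower {F L : Type*} [Field F] [Field L] [CharP L p]
    [Algebra F L] [FiniteDimensional F L] [Algebra.IsSeparable F L] {m : ℕ} {x : ℕ → L}
    (hx : ∀ l < m, x l ^ p - x l ∈ adjoin F (x '' Set.Iio l))
    (htop : adjoin F (x '' Set.Iio m) = ⊤) (hfr : Module.finrank F L = p ^ m) :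
    Algebra.trace F L (∏ l ∈ Finset.range m, x l ^ (p - 1)) = (-1) ^ m := by
  have hle : ∀ S : Set L, adjoin F S ≤
      (adjoin (⊥ : IntermediateField F L) S).restrictScalars F := fun S => by
    rw [adjoin_le_iff]
    exact subset_adjoin _ _
  have hfr1 : Module.finrank F (⊥ : IntermediateField F L) = 1 :=
    IntermediateField.finrank_bot
  have hfr' : Module.finrank (⊥ : IntermediateField F L) L = p ^ m := by
    rw [← hfr, ← Module.finrank_mul_finrank F (⊥ : IntermediateField F L) L, hfr1, one_mul]
  have h := trace_prod_pow_of_artinSchreier_tower_aux m (⊥ : IntermediateField F L) x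
    (fun l hl => hle _ (hx l hl)) (eq_top_iff.mpr fun z _ => hle _ (htop ▸ mem_top)) hfr'
  rw [← Algebra.trace_trace (S := (⊥ : IntermediateField F L)), h]
  have : ((-1) ^ m : (⊥ : IntermediateField F L)) = algebraMap F _ ((-1) ^ m) := by simp
  rw [this, Algebra.trace_algebraMap, hfr1, one_smul]

end TraceTower

namespace AddValuation

section TotallyRamified

variable {K L : Type*} [Field K] [Field L] [Algebra K L] (w : AddValuation L (WithTop ℤ)) {N : ℕ}
  (hK : ∀ x : K, x ≠ 0 → ∃ a : ℤ, w (algebraMap K L x) = ((N * a : ℤ) : WithTop ℤ))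

include hK in
theorem coe_mul_le_algebraMap {x : K} {a r : ℤ} (hr : r < N)
    (h : ((N * a - r : ℤ) : WithTop ℤ) ≤ w (algebraMap K L x)) :
    ((N * a : ℤ) : WithTop ℤ) ≤ w (algebraMap K L x) := by
  by_cases hx : x = 0
  · simp [hx]
  obtain ⟨b, hb⟩ := hK x hx
  rw [hb, WithTop.coe_le_coe] at h ⊢
  by_contra hlt
  have h1 : (N : ℤ) * b < N * a := by omega
  have hN : (0 : ℤ) ≤ N := by positivity
  have h2 : b < a := lt_of_mul_lt_mul_left h1 hN
  have h3 : (N : ℤ) * (b + 1) ≤ N * a := mul_le_mul_of_nonneg_left h2 hN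
  linarith

variable {t : L} (ht : w t = ((1 : ℤ) : WithTop ℤ))

include ht in
theorem algebraMap_mul_pow {x : K} {a : ℤ} (hx : w (algebraMap K L x) = a) (i : ℕ) :
    w (algebraMap K L x * t ^ i) = ((a + i : ℤ) : WithTop ℤ) := by
  rw [w.map_mul, hx, w.pow_eq_coe ht, ← WithTop.coe_add, mul_one]

include ht in
theorem uniformizer_ne_zero : t ≠ 0 := by
  rintro rfl
  simp at ht

include hK ht in
theorem eq_of_algebraMap_mul_pow_eq {c c' : K} {i j : ℕ} (hi : i < N) (hj : j < N) (hc : c ≠ 0)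
    (h : w (algebraMap K L c * t ^ i) = w (algebraMap K L c' * t ^ j)) : i = j := by
  have hc' : c' ≠ 0 := by
    rintro rfl
    rw [_root_.map_zero, zero_mul, w.map_zero, w.top_iff, mul_eq_zero, map_eq_zero] at h
    exact h.elim hc (pow_ne_zero _ (w.uniformizer_ne_zero ht))
  obtain ⟨a, ha⟩ := hK c hc
  obtain ⟨b, hb⟩ := hK c' hc'
  rw [w.algebraMap_mul_pow ht ha, w.algebraMap_mul_pow ht hb, WithTop.coe_eq_coe] at h
  have h1 : ((i : ℤ) - j) % N = 0 := by
    have : (i : ℤ) - j = N * (b - a) := by linarith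
    rw [this, Int.mul_emod_right]
  have h2 : (i : ℤ) % N = (j : ℤ) % N := by
    exact Int.emod_eq_emod_iff_emod_sub_eq_zero.mpr h1
  rw [Int.emod_eq_of_lt (by positivity) (by exact_mod_cast hi),
    Int.emod_eq_of_lt (by positivity) (by exact_mod_cast hj)] at h2
  exact_mod_cast h2

include hK ht in
theorem exists_addValuation_sum_eq (hN : 0 < N) (c : ℕ → K) :
    ∃ i < N, w (∑ i ∈ Finset.range N, algebraMap K L (c i) * t ^ i) =
        w (algebraMap K L (c i) * t ^ i) ∧
      ∀ l < N, w (algebraMap K L (c i) * t ^ i) ≤ w (algebraMap K L (c l) * t ^ l) := by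
  obtain ⟨i, hi, hmin⟩ := Finset.exists_min_image (Finset.range N)
    (fun i => w (algebraMap K L (c i) * t ^ i)) ⟨0, Finset.mem_range.mpr hN⟩
  have hi' := Finset.mem_range.mp hi
  refine ⟨i, hi', ?_, fun l hl => hmin l (Finset.mem_range.mpr hl)⟩
  by_cases hc : c i = 0
  · rw [hc, _root_.map_zero, zero_mul, w.map_zero, eq_top_iff]
    refine w.map_le_sum fun l hl => ?_
    simpa [hc] using hmin l hl
  rw [← Finset.add_sum_erase _ _ hi]
  refine w.map_add_eq_of_lt_left (w.map_lt_sum ?_ fun l hl => ?_)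
  · rw [w.ne_top_iff]
    exact mul_ne_zero (by simpa using hc) (pow_ne_zero _ (w.uniformizer_ne_zero ht))
  · obtain ⟨hne, hl⟩ := Finset.mem_erase.mp hl
    refine lt_of_le_of_ne (hmin l hl) fun h => hne ?_
    exact (w.eq_of_algebraMap_mul_pow_eq hK ht hi' (Finset.mem_range.mp hl) hc h).symm

include hK ht in
theorem le_algebraMap_mul_pow_of_le_sum {c : ℕ → K} {a : WithTop ℤ}
    (h : a ≤ w (∑ i ∈ Finset.range N, algebraMap K L (c i) * t ^ i)) {l : ℕ} (hl : l < N) :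
    a ≤ w (algebraMap K L (c l) * t ^ l) := by
  obtain ⟨i, -, h1, h2⟩ := w.exists_addValuation_sum_eq hK ht (by omega) c
  exact (h.trans h1.le).trans (h2 l hl)

include ht in
theorem le_algebraMap_of_le_mul_pow {c : K} {a : ℤ} {i : ℕ}
    (h : (a : WithTop ℤ) ≤ w (algebraMap K L c * t ^ i)) :
    ((a - i : ℤ) : WithTop ℤ) ≤ w (algebraMap K L c) := by
  by_cases hc : c = 0
  · simp [hc]
  obtain ⟨b, hb⟩ := w.exists_eq_coe (x := algebraMap K L c) (by simpa using hc)
  rw [w.algebraMap_mul_pow ht hb, WithTop.coe_le_coe] at h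
  rw [hb, WithTop.coe_le_coe]
  linarith

include hK ht in
theorem exists_powerBasis_gen_eq [FiniteDimensional K L] (hN : Module.finrank K L = N) :
    ∃ pb : PowerBasis K L, pb.gen = t ∧ pb.dim = N := by
  have hli : LinearIndependent K (fun i : Fin N => t ^ (i : ℕ)) := by
    rw [Fintype.linearIndependent_iff]
    intro g hg i
    have hN0 : 0 < N := i.pos
    let c : ℕ → K := fun l => if h : l < N then g ⟨l, h⟩ else 0
    have hsum : ∑ l ∈ Finset.range N, algebraMap K L (c l) * t ^ l = 0 := by
      rw [Finset.sum_range, ← hg]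
      refine Finset.sum_congr rfl fun l _ => ?_
      simp [c, Algebra.smul_def]
    have h := w.le_algebraMap_mul_pow_of_le_sum hK ht (c := c) (a := ⊤) (by rw [hsum]; simp)
      i.isLt
    rw [top_le_iff, w.top_iff, mul_eq_zero, map_eq_zero] at h
    have h2 := h.resolve_right (pow_ne_zero _ (w.uniformizer_ne_zero ht))
    simpa [c] using h2
  have : Nonempty (Fin N) := ⟨⟨0, hN ▸ Module.finrank_pos⟩⟩
  exact ⟨⟨t, N, basisOfLinearIndependentOfCardEqFinrank hli (by simp [hN]), by simp⟩, rfl, rfl⟩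

include hK ht in
theorem exists_eq_sum_algebraMap_mul_pow [FiniteDimensional K L] (hN : Module.finrank K L = N)
    (z : L) : ∃ c : ℕ → K, z = ∑ i ∈ Finset.range N, algebraMap K L (c i) * t ^ i := by
  obtain ⟨pb, rfl, hdim⟩ := w.exists_powerBasis_gen_eq hK ht hN
  subst hdim
  refine ⟨fun l => if h : l < pb.dim then pb.basis.repr z ⟨l, h⟩ else 0, ?_⟩
  conv_lhs => rw [← pb.basis.sum_repr z]
  rw [Finset.sum_range]
  refine Finset.sum_congr rfl fun l _ => ?_
  simp [Algebra.smul_def]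

open Polynomial

include hK ht in
theorem le_algebraMap_trace [FiniteDimensional K L] [Algebra.IsSeparable K L]
    (hN : Module.finrank K L = N) {δ a : ℤ}
    (hδ : w (aeval t (derivative (minpoly K t))) = (δ : WithTop ℤ)) {z : L}
    (hz : ((N * a - δ : ℤ) : WithTop ℤ) ≤ w z) :
    ((N * a : ℤ) : WithTop ℤ) ≤ w (algebraMap K L (Algebra.trace K L z)) := by
  have hN0 : 0 < N := hN ▸ Module.finrank_pos
  obtain ⟨pb, rfl, hdim⟩ := w.exists_powerBasis_gen_eq hK ht hN
  obtain ⟨c, hc⟩ := w.exists_eq_sum_algebraMap_mul_pow hK ht hN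
    (aeval pb.gen (derivative (minpoly K pb.gen)) * z)
  have h0 : aeval pb.gen (derivative (minpoly K pb.gen)) ≠ 0 := by
    rw [← w.ne_top_iff, hδ]
    exact WithTop.coe_ne_top
  have hz' := w.coe_le_mul hδ.ge hz
  rw [hc] at hz'
  have h1 := w.le_algebraMap_of_le_mul_pow ht
    (w.le_algebraMap_mul_pow_of_le_sum hK ht hz' (Nat.sub_lt hN0 one_pos))
  have htr : Algebra.trace K L z = c (N - 1) := by
    have h2 : z = ∑ i ∈ Finset.range N, c i •
        (pb.gen ^ i / aeval pb.gen (derivative (minpoly K pb.gen))) := by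
      rw [eq_comm, ← mul_right_inj' h0, hc, Finset.mul_sum]
      refine Finset.sum_congr rfl fun i _ => ?_
      rw [Algebra.smul_def]
      field_simp
    rw [h2, map_sum, Finset.sum_eq_single (N - 1)]
    · rw [map_smul, pb.trace_gen_pow_div_aeval_derivative (by omega), if_pos (by omega)]
      simp
    · intro i hi hne
      rw [map_smul, pb.trace_gen_pow_div_aeval_derivative (hdim ▸ Finset.mem_range.mp hi),
        if_neg, smul_zero]
      have := Finset.mem_range.mp hi
      omega
    · intro h
      exact absurd (Finset.mem_range.mpr (by omega)) h
  rw [htr]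
  refine w.coe_mul_le_algebraMap hK (r := N - 1) (by omega) (le_trans (le_of_eq ?_) h1)
  congr 1
  push_cast [Nat.cast_sub (show 1 ≤ N from hN0)]
  ring

end TotallyRamified

end AddValuation

namespace AddValuation

open Polynomial

theorem _root_.Derivation.apply_aeval_eq_sum {K L : Type*} [Field K] [Field L] [Algebra K L]
    (D : Derivation ℤ L L) (f : K[X]) (t : L) :
    D (aeval t f) = ∑ i ∈ Finset.range (f.natDegree + 1), D (algebraMap K L (f.coeff i)) * t ^ i +
      aeval t (derivative f) * D t := by
  rw [derivative_apply, sum_over_range _ (by simp), aeval_eq_sum_range, map_sum, map_sum,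
    Finset.sum_mul, ← Finset.sum_add_distrib]
  refine Finset.sum_congr rfl fun i _ => ?_
  rw [Algebra.smul_def, D.leibniz, D.leibniz_pow]
  simp only [smul_eq_mul, nsmul_eq_mul, _root_.map_mul, aeval_C, _root_.map_pow, aeval_X,
    map_natCast]
  ring

theorem intCast_nonneg {L : Type*} [Field L] (w : AddValuation L (WithTop ℤ)) (a : ℤ) :
    0 ≤ w (a : L) :=
  intCast_mem w.nonnegSubring a

theorem map_intCast_eq_zero {L : Type*} [Field L] (w : AddValuation L (WithTop ℤ)) {p : ℕ}
    [Fact p.Prime] [CharP L p] {a : ℤ} (ha : ¬ (p : ℤ) ∣ a) : w (a : L) = ((0 : ℤ) : WithTop ℤ) := by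
  have hcop : IsCoprime (p : ℤ) a :=
    (Nat.prime_iff_prime_int.mp Fact.out).coprime_iff_not_dvd.mpr ha
  obtain ⟨x, y, hxy⟩ := hcop
  have h1 : (y : L) * (a : L) = 1 := by
    have h := congrArg (Int.cast : ℤ → L) hxy
    push_cast at h
    rwa [CharP.cast_eq_zero, mul_zero, zero_add] at h
  have h2 := congrArg w h1
  rw [w.map_mul, w.map_one] at h2
  have h3 := w.intCast_nonneg a
  have h4 := w.intCast_nonneg y
  refine le_antisymm ?_ h3
  calc w (a : L) = 0 + w (a : L) := (zero_add _).symm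
    _ ≤ w (y : L) + w (a : L) := by gcongr
    _ = 0 := h2

section TotallyRamified

variable {K L : Type*} [Field K] [Field L] [Algebra K L] (w : AddValuation L (WithTop ℤ)) {N : ℕ}
  (hK : ∀ x : K, x ≠ 0 → ∃ a : ℤ, w (algebraMap K L x) = ((N * a : ℤ) : WithTop ℤ))
  {t : L} (ht : w t = ((1 : ℤ) : WithTop ℤ))

include hK ht in
theorem natDegree_minpoly_uniformizer [FiniteDimensional K L] (hN : Module.finrank K L = N) :
    (minpoly K t).natDegree = N := by
  obtain ⟨pb, rfl, hdim⟩ := w.exists_powerBasis_gen_eq hK ht hN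
  rw [pb.natDegree_minpoly, hdim]

include hK ht in
theorem coeff_minpoly_uniformizer [FiniteDimensional K L] (hN : Module.finrank K L = N) :
    (∀ i < N, ((N : ℤ) : WithTop ℤ) ≤ w (algebraMap K L ((minpoly K t).coeff i))) ∧
      w (algebraMap K L ((minpoly K t).coeff 0)) = ((N : ℤ) : WithTop ℤ) := by
  have hN0 : 0 < N := hN ▸ Module.finrank_pos
  have hdeg := w.natDegree_minpoly_uniformizer hK ht hN
  have hmon := minpoly.monic (Algebra.IsIntegral.isIntegral (R := K) t)
  have hroot := minpoly.aeval K t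
  rw [aeval_eq_sum_range, hdeg, Finset.sum_range_succ] at hroot
  have hlead : (minpoly K t).coeff N = 1 := by rw [← hdeg]; exact hmon
  rw [hlead, one_smul] at hroot
  simp only [Algebra.smul_def] at hroot
  have hw : w (∑ i ∈ Finset.range N, algebraMap K L ((minpoly K t).coeff i) * t ^ i) =
      ((N : ℤ) : WithTop ℤ) := by
    rw [eq_neg_of_add_eq_zero_left hroot, w.map_neg, w.pow_eq_coe ht, mul_one]
  have hle : ∀ i < N, ((N : ℤ) : WithTop ℤ) ≤ w (algebraMap K L ((minpoly K t).coeff i)) := by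
    intro i hi
    have h := w.le_algebraMap_of_le_mul_pow ht
      (w.le_algebraMap_mul_pow_of_le_sum hK ht hw.ge hi)
    have h' := w.coe_mul_le_algebraMap hK (a := 1) (r := i) (by exact_mod_cast hi)
      (by rwa [mul_one])
    rwa [mul_one] at h'
  refine ⟨hle, ?_⟩
  obtain ⟨i, hi, h1, -⟩ := w.exists_addValuation_sum_eq hK ht hN0 (minpoly K t).coeff
  rw [hw] at h1
  have hc : (minpoly K t).coeff i ≠ 0 := by
    intro h0
    rw [h0, _root_.map_zero, zero_mul, w.map_zero] at h1
    exact WithTop.coe_ne_top h1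
  obtain ⟨a, ha⟩ := hK _ hc
  rw [w.algebraMap_mul_pow ht ha, WithTop.coe_eq_coe] at h1
  have h2 := hle i hi
  rw [ha, WithTop.coe_le_coe] at h2
  have hi0 : i = 0 := by omega
  subst hi0
  rw [ha, WithTop.coe_eq_coe]
  simpa using h1.symm

variable (D : Derivation ℤ L L) (hD0 : ∀ x : K, 0 ≤ w (algebraMap K L x) →
    0 ≤ w (D (algebraMap K L x)))
  (hD1 : ∀ x : K, w (algebraMap K L x) = ((N : ℤ) : WithTop ℤ) →
    w (D (algebraMap K L x)) = ((0 : ℤ) : WithTop ℤ))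

include hK ht in
theorem exists_aeval_derivative_minpoly_eq_coe [FiniteDimensional K L] [Algebra.IsSeparable K L]
    (hN : Module.finrank K L = N) :
    ∃ δ : ℕ, w (aeval t (derivative (minpoly K t))) = ((δ : ℤ) : WithTop ℤ) := by
  have hne : aeval t (derivative (minpoly K t)) ≠ 0 :=
    (Algebra.IsSeparable.isSeparable K t).aeval_derivative_ne_zero (minpoly.aeval K t)
  obtain ⟨δ, hδ⟩ := w.exists_eq_coe hne
  have h0 : 0 ≤ w (aeval t (derivative (minpoly K t))) := by
    rw [derivative_apply, sum_over_range _ (by simp), map_sum,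
      w.natDegree_minpoly_uniformizer hK ht hN]
    refine w.map_le_sum fun i hi => ?_
    simp only [_root_.map_mul, aeval_C, _root_.map_pow, aeval_X, map_natCast]
    have hmon := minpoly.monic (Algebra.IsIntegral.isIntegral (R := K) t)
    have hcoeff : algebraMap K L ((minpoly K t).coeff i) ∈ w.nonnegSubring := by
      rcases (Nat.lt_succ_iff.mp (Finset.mem_range.mp hi)).lt_or_eq with h | rfl
      · refine le_trans ?_ ((w.coeff_minpoly_uniformizer hK ht hN).1 i h)
        exact_mod_cast Int.natCast_nonneg N
      · rw [← w.natDegree_minpoly_uniformizer hK ht hN, hmon.coeff_natDegree, _root_.map_one]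
        exact one_mem _
    have htmem : t ∈ w.nonnegSubring := by
      change 0 ≤ w t
      rw [ht]
      exact_mod_cast Int.one_nonneg
    exact mul_mem (mul_mem hcoeff (natCast_mem _ i)) (pow_mem htmem _)
  rw [hδ] at h0
  have h0' : 0 ≤ δ := by exact_mod_cast h0
  exact ⟨δ.toNat, by rw [Int.toNat_of_nonneg h0', hδ]⟩

include hK ht hD0 hD1 in
theorem deriv_uniformizer [FiniteDimensional K L] (hN : Module.finrank K L = N) {δ : ℤ}
    (hδ : w (aeval t (derivative (minpoly K t))) = (δ : WithTop ℤ)) :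
    w (D t) = ((-δ : ℤ) : WithTop ℤ) := by
  have hN0 : 0 < N := hN ▸ Module.finrank_pos
  have hdeg := w.natDegree_minpoly_uniformizer hK ht hN
  have hmon := minpoly.monic (Algebra.IsIntegral.isIntegral (R := K) t)
  obtain ⟨h1, h2⟩ := w.coeff_minpoly_uniformizer hK ht hN
  have h := D.apply_aeval_eq_sum (minpoly K t) t
  have hlead : (minpoly K t).coeff N = 1 := by rw [← hdeg]; exact hmon
  rw [minpoly.aeval, _root_.map_zero, hdeg, Finset.sum_range_succ, hlead, _root_.map_one,
    D.map_one_eq_zero, zero_mul, add_zero] at h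
  have hsum : w (∑ i ∈ Finset.range N, D (algebraMap K L ((minpoly K t).coeff i)) * t ^ i) =
      ((0 : ℤ) : WithTop ℤ) := by
    rw [← Finset.add_sum_erase _ _ (Finset.mem_range.mpr hN0), pow_zero, mul_one]
    rw [w.map_add_eq_of_lt_left, hD1 _ h2]
    rw [hD1 _ h2]
    refine w.map_lt_sum WithTop.coe_ne_top fun i hi => ?_
    obtain ⟨hne, hi⟩ := Finset.mem_erase.mp hi
    have hi' := Finset.mem_range.mp hi
    have h3 : 0 ≤ w (D (algebraMap K L ((minpoly K t).coeff i))) :=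
      hD0 _ (le_trans (by exact_mod_cast Int.natCast_nonneg N) (h1 i hi'))
    have h4 := w.coe_le_mul (a := 0) h3 (w.pow_eq_coe ht i).ge
    refine lt_of_lt_of_le ?_ h4
    rw [WithTop.coe_lt_coe]
    omega
  have h5 : w (aeval t (derivative (minpoly K t)) * D t) = ((0 : ℤ) : WithTop ℤ) := by
    rw [eq_neg_of_add_eq_zero_left (a := aeval t (derivative (minpoly K t)) * D t)
      (by rw [add_comm]; exact h.symm), w.map_neg, hsum]
  have hDt : D t ≠ 0 := by
    intro h0
    rw [h0, mul_zero, w.map_zero] at h5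
    exact WithTop.coe_ne_top h5.symm
  obtain ⟨b, hb⟩ := w.exists_eq_coe hDt
  rw [w.map_mul, hδ, hb, ← WithTop.coe_add, WithTop.coe_eq_coe] at h5
  rw [hb, WithTop.coe_eq_coe]
  linarith

include hK ht hD0 in
theorem neg_le_deriv_of_nonneg [FiniteDimensional K L] (hN : Module.finrank K L = N) {δ : ℕ}
    (hDt : w (D t) = ((-δ : ℤ) : WithTop ℤ)) {x : L} (hx : 0 ≤ w x) :
    ((-δ : ℤ) : WithTop ℤ) ≤ w (D x) := by
  obtain ⟨c, rfl⟩ := w.exists_eq_sum_algebraMap_mul_pow hK ht hN x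
  rw [map_sum]
  refine w.map_le_sum fun i hi => ?_
  have hi' := Finset.mem_range.mp hi
  have h1 := w.le_algebraMap_mul_pow_of_le_sum hK ht hx hi'
  have h2 := w.le_algebraMap_of_le_mul_pow ht (a := 0) h1
  have h3 : ((0 : ℤ) : WithTop ℤ) ≤ w (algebraMap K L (c i)) := by
    have := w.coe_mul_le_algebraMap hK (a := 0) (r := i) (by exact_mod_cast hi')
      (by rwa [mul_zero])
    rwa [mul_zero] at this
  have htpow : ∀ i : ℕ, ((0 : ℤ) : WithTop ℤ) ≤ w (t ^ i) := fun i => by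
    rw [w.pow_eq_coe ht, WithTop.coe_le_coe]
    positivity
  rw [D.leibniz, D.leibniz_pow, smul_eq_mul, smul_eq_mul, smul_eq_mul, nsmul_eq_mul, mul_comm (t ^ i)]
  refine w.map_le_add ?_ (le_trans ?_ (w.coe_le_mul (hD0 _ h3) (htpow i)))
  · have h4 : ((0 : ℤ) : WithTop ℤ) ≤ w ((i : ℕ) : L) := natCast_mem w.nonnegSubring i
    refine le_trans (le_of_eq ?_) (w.coe_le_mul h3 (w.coe_le_mul h4
      (w.coe_le_mul (htpow (i - 1)) hDt.ge)))
    congr 1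
    ring
  · rw [WithTop.coe_le_coe]
    linarith [Int.natCast_nonneg δ]

theorem deriv_zpow_mul (a : ℤ) (ε : L) :
    D (t ^ a * ε) = t ^ a * D ε + (a : L) * (t ^ (a - 1) * (ε * D t)) := by
  rw [D.leibniz, D.leibniz_zpow, smul_eq_mul, smul_eq_mul, smul_eq_mul, zsmul_eq_mul]
  ring

include ht in
theorem exists_eq_zpow_mul {x : L} {a : ℤ} (hx : w x = (a : WithTop ℤ)) :
    ∃ ε, w ε = ((0 : ℤ) : WithTop ℤ) ∧ x = t ^ a * ε := by
  refine ⟨t ^ (-a) * x, ?_, ?_⟩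
  · rw [w.map_mul, w.zpow_eq_coe ht, hx, ← WithTop.coe_add]
    congr 1
    ring
  · rw [← mul_assoc, ← zpow_add₀ (w.uniformizer_ne_zero ht), add_neg_cancel, zpow_zero, one_mul]

include hK ht hD0 in
theorem le_deriv [FiniteDimensional K L] (hN : Module.finrank K L = N) {δ : ℕ}
    (hDt : w (D t) = ((-δ : ℤ) : WithTop ℤ)) {x : L} {a : ℤ} (hx : w x = (a : WithTop ℤ)) :
    ((a - 1 - δ : ℤ) : WithTop ℤ) ≤ w (D x) := by
  obtain ⟨ε, hε, rfl⟩ := w.exists_eq_zpow_mul ht hx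
  rw [deriv_zpow_mul]
  refine w.map_le_add (le_trans ?_ (w.coe_le_mul (w.zpow_eq_coe ht a).ge
    (w.neg_le_deriv_of_nonneg hK ht D hD0 hN hDt hε.ge))) (le_trans ?_ (w.coe_le_mul (a := 0)
      (w.intCast_nonneg a) (w.coe_le_mul (w.zpow_eq_coe ht (a - 1)).ge
        (w.coe_le_mul hε.ge hDt.ge))))
  · rw [WithTop.coe_le_coe]
    linarith
  · rw [WithTop.coe_le_coe]
    linarith

include hK ht hD0 in
theorem deriv_eq [FiniteDimensional K L] (hN : Module.finrank K L = N) {δ p : ℕ} [Fact p.Prime]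
    [CharP L p] (hDt : w (D t) = ((-δ : ℤ) : WithTop ℤ)) {x : L} {a : ℤ}
    (hx : w x = (a : WithTop ℤ)) (ha : ¬ (p : ℤ) ∣ a) :
    w (D x) = ((a - 1 - δ : ℤ) : WithTop ℤ) := by
  obtain ⟨ε, hε, rfl⟩ := w.exists_eq_zpow_mul ht hx
  have h1 : w ((a : L) * (t ^ (a - 1) * (ε * D t))) = ((a - 1 - δ : ℤ) : WithTop ℤ) := by
    rw [w.map_mul, w.map_mul, w.map_mul, w.map_intCast_eq_zero ha, w.zpow_eq_coe ht, hε, hDt,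
      ← WithTop.coe_add, ← WithTop.coe_add, ← WithTop.coe_add]
    congr 1
    ring
  rw [deriv_zpow_mul, w.map_add_eq_of_lt_right, h1]
  rw [h1]
  refine lt_of_lt_of_le ?_ (w.coe_le_mul (w.zpow_eq_coe ht a).ge
    (w.neg_le_deriv_of_nonneg hK ht D hD0 hN hDt hε.ge))
  rw [WithTop.coe_lt_coe]
  linarith

end TotallyRamified

end AddValuation

namespace AddValuation

open Polynomial

section Different

variable {K L : Type*} [Field K] [Field L] [Algebra K L] (w : AddValuation L (WithTop ℤ)) {N : ℕ}
  (hK : ∀ x : K, x ≠ 0 → ∃ a : ℤ, w (algebraMap K L x) = ((N * a : ℤ) : WithTop ℤ))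
  {OL OK : Subring L} (hOL : ∀ z, z ∈ OL ↔ 0 ≤ w z)
  (hOK : ∀ z, z ∈ OK ↔ ∃ x : K, 0 ≤ w (algebraMap K L x) ∧ algebraMap K L x = z)
  [Algebra OK OL] (halg : ∀ c : OK, ((algebraMap OK OL c : OL) : L) = c)
  {t : OL} (ht : w (t : L) = ((1 : ℤ) : WithTop ℤ))

include halg in
omit [Algebra K L] in
theorem coe_aeval_eq_eval_map {K : Type*} [Field K] [Algebra K L] {F : OK[X]} {f : K[X]}
    (h : F.map OK.subtype = f.map (algebraMap K L)) : ((aeval t F : OL) : L) = aeval (t : L) f := by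
  have hcomp : OL.subtype.comp (algebraMap OK OL) = OK.subtype := RingHom.ext halg
  have h1 : OL.subtype (aeval t F) = eval₂ (OL.subtype.comp (algebraMap OK OL)) (OL.subtype t) F := by
    rw [aeval_def, hom_eval₂]
  rw [hcomp, eval₂_eq_eval_map, h, ← eval₂_eq_eval_map, ← aeval_def] at h1
  exact h1

include hK hOL hOK halg ht in
theorem exists_aeval_eq [FiniteDimensional K L] (hN : Module.finrank K L = N) (x : OL) :
    ∃ g : OK[X], aeval t g = x := by
  obtain ⟨c, hc⟩ := w.exists_eq_sum_algebraMap_mul_pow hK ht hN (x : L)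
  have hx := (hOL _).mp x.2
  rw [hc] at hx
  have hmem : ∀ i, ∃ c' : OK, i < N → (c' : L) = algebraMap K L (c i) := by
    intro i
    by_cases hi : i < N
    · refine ⟨⟨algebraMap K L (c i), (hOK _).mpr ⟨c i, ?_, rfl⟩⟩, fun _ => rfl⟩
      have h1 := w.le_algebraMap_mul_pow_of_le_sum hK ht hx hi
      have h2 := w.le_algebraMap_of_le_mul_pow ht (a := 0) h1
      have := w.coe_mul_le_algebraMap hK (a := 0) (r := i) (by exact_mod_cast hi)
        (by rwa [mul_zero])
      rwa [mul_zero] at this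
    · exact ⟨0, fun h => absurd h hi⟩
  choose c' hc' using hmem
  refine ⟨∑ i ∈ Finset.range N, C (c' i) * X ^ i, Subtype.ext ?_⟩
  rw [hc, map_sum, AddSubmonoidClass.coe_finsetSum]
  refine Finset.sum_congr rfl fun i hi => ?_
  rw [_root_.map_mul, aeval_C, _root_.map_pow, aeval_X, Subring.coe_mul, halg, Subring.coe_pow,
    hc' i (Finset.mem_range.mp hi)]

include hK hOK ht in
omit [Algebra OK OL] in
theorem minpoly_uniformizer_mem_lifts [FiniteDimensional K L] (hN : Module.finrank K L = N) :
    ∃ F : OK[X], F.map OK.subtype = (minpoly K (t : L)).map (algebraMap K L) := by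
  have hmon := minpoly.monic (Algebra.IsIntegral.isIntegral (R := K) (t : L))
  have hdeg := w.natDegree_minpoly_uniformizer hK ht hN
  rw [← mem_lifts, lifts_iff_coeff_lifts]
  intro i
  rw [coeff_map]
  refine ⟨⟨algebraMap K L ((minpoly K (t : L)).coeff i), (hOK _).mpr ⟨_, ?_, rfl⟩⟩, rfl⟩
  rcases lt_trichotomy i N with h | rfl | h
  · refine le_trans ?_ ((w.coeff_minpoly_uniformizer hK ht hN).1 i h)
    exact_mod_cast Int.natCast_nonneg N
  · have : (minpoly K (t : L)).coeff i = 1 := by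
      conv_lhs => rw [← hdeg]
      exact hmon
    rw [this, _root_.map_one, w.map_one]
  · rw [coeff_eq_zero_of_natDegree_lt (by omega), _root_.map_zero, w.map_zero]
    exact le_top

include hK hOL hOK halg ht in
theorem le_of_annihilator_kaehlerDifferential_eq [FiniteDimensional K L]
    (hN : Module.finrank K L = N) {d δ : ℕ}
    (hδ : w (aeval (t : L) (derivative (minpoly K (t : L)))) = ((δ : ℤ) : WithTop ℤ))
    (hd : Module.annihilator OL (KaehlerDifferential OK OL) = Ideal.span {t} ^ d) : d ≤ δ := by
  obtain ⟨F, hF⟩ := w.minpoly_uniformizer_mem_lifts hK hOK ht hN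
  have hF0 : aeval t F = 0 := Subtype.ext (by
    rw [coe_aeval_eq_eval_map halg hF, minpoly.aeval]
    rfl)
  have hF' : ((aeval t (derivative F) : OL) : L) =
      aeval (t : L) (derivative (minpoly K (t : L))) :=
    coe_aeval_eq_eval_map halg (by rw [← derivative_map, hF, derivative_map])
  have hmem : aeval t (derivative F) ∈ Module.annihilator OL (KaehlerDifferential OK OL) := by
    rw [Module.mem_annihilator]
    intro m
    have hm : m ∈ Submodule.span OL (Set.range (KaehlerDifferential.D OK OL)) := by
      rw [KaehlerDifferential.span_range_derivation]
      exact Submodule.mem_top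
    induction hm using Submodule.span_induction with
    | mem m hm =>
      obtain ⟨x, rfl⟩ := hm
      obtain ⟨g, rfl⟩ := w.exists_aeval_eq hK hOL hOK halg ht hN x
      rw [Derivation.map_aeval, smul_comm, ← Derivation.map_aeval, hF0, _root_.map_zero, smul_zero]
    | zero => exact smul_zero _
    | add a b _ _ ha hb => rw [smul_add, ha, hb, add_zero]
    | smul r a _ ha => rw [smul_comm, ha, smul_zero]
  rw [hd, Ideal.span_singleton_pow, Ideal.mem_span_singleton] at hmem
  obtain ⟨b, hb⟩ := hmem
  have h1 : ((d + 0 : ℤ) : WithTop ℤ) ≤ w (((t : L) ^ d) * (b : L)) :=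
    w.coe_le_mul (by rw [w.pow_eq_coe ht, mul_one]) ((hOL _).mp b.2)
  rw [show ((t : L) ^ d) * (b : L) = ((aeval t (derivative F) : OL) : L) by rw [hb]; rfl, hF', hδ,
    WithTop.coe_le_coe] at h1
  omega

include hOL hOK halg ht in
theorem ge_of_annihilator_kaehlerDifferential_eq {d δ : ℕ} {φ : OL}
    (hφ : w (φ : L) = ((δ : ℤ) : WithTop ℤ)) (D : Derivation ℤ L L)
    (hD0 : ∀ x : K, 0 ≤ w (algebraMap K L x) → 0 ≤ w (D (algebraMap K L x)))
    (hDt : w (D t) = ((-δ : ℤ) : WithTop ℤ))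
    (hD : ∀ x, 0 ≤ w x → ((-δ : ℤ) : WithTop ℤ) ≤ w (D x))
    (hd : Module.annihilator OL (KaehlerDifferential OK OL) = Ideal.span {t} ^ d) : δ ≤ d := by
  have hmem : ∀ x : OL, (φ : L) * D x ∈ OL := fun x => by
    rw [hOL]
    refine le_trans (le_of_eq ?_) (w.coe_le_mul hφ.ge (hD x ((hOL _).mp x.2)))
    rw [add_neg_cancel]
    rfl
  let I : Ideal OL := Ideal.span {φ}
  have hadd : ∀ x y : OL, (⟨(φ : L) * D ((x + y : OL) : L), hmem (x + y)⟩ : OL) =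
      ⟨(φ : L) * D x, hmem x⟩ + ⟨(φ : L) * D y, hmem y⟩ := fun x y => Subtype.ext (by
    change (φ : L) * D ((x : L) + y) = φ * D x + φ * D y
    rw [_root_.map_add, mul_add])
  have hmul : ∀ x y : OL, (⟨(φ : L) * D ((x * y : OL) : L), hmem (x * y)⟩ : OL) =
      x * ⟨(φ : L) * D y, hmem y⟩ + y * ⟨(φ : L) * D x, hmem x⟩ := fun x y => Subtype.ext (by
    change (φ : L) * D ((x : L) * y) = x * (φ * D y) + y * (φ * D x)
    rw [D.leibniz, smul_eq_mul, smul_eq_mul]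
    ring)
  have hconst : ∀ c : OK, (⟨(φ : L) * D (algebraMap OK OL c : OL), hmem _⟩ : OL) ∈ I := fun c => by
    obtain ⟨x, hx, hxc⟩ := (hOK _).mp c.2
    refine Ideal.mem_span_singleton.mpr ⟨⟨D c, (hOL _).mpr ?_⟩, Subtype.ext ?_⟩
    · rw [← hxc]
      exact hD0 x hx
    · change (φ : L) * D ((algebraMap OK OL c : OL) : L) = φ * D c
      rw [halg]
  let E : Derivation OK OL (OL ⧸ I) := Derivation.mk'
    { toFun := fun x => Ideal.Quotient.mk I ⟨(φ : L) * D x, hmem x⟩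
      map_add' := fun x y => by rw [hadd, _root_.map_add]
      map_smul' := fun c x => by
        rw [RingHom.id_apply, Algebra.smul_def c x, hmul, _root_.map_add, _root_.map_mul,
          _root_.map_mul (Ideal.Quotient.mk I) x, Ideal.Quotient.eq_zero_iff_mem.mpr (hconst c),
          mul_zero, add_zero,
          Algebra.smul_def c (Ideal.Quotient.mk I _)]
        rfl }
    (fun x y => by
      change Ideal.Quotient.mk I _ = _
      rw [hmul, _root_.map_add, _root_.map_mul, _root_.map_mul (Ideal.Quotient.mk I) y]
      rfl)
  have htd : t ^ d ∈ Module.annihilator OL (KaehlerDifferential OK OL) := by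
    rw [hd]
    exact Ideal.pow_mem_pow (Ideal.mem_span_singleton_self t) d
  have h1 := Module.mem_annihilator.mp htd (KaehlerDifferential.D OK OL t)
  have h2 := congrArg E.liftKaehlerDifferential h1
  rw [map_smul, Derivation.liftKaehlerDifferential_comp_D, _root_.map_zero] at h2
  have h3 : Ideal.Quotient.mk I (t ^ d * ⟨(φ : L) * D t, hmem t⟩) = 0 := by
    rw [_root_.map_mul]
    exact h2
  obtain ⟨b, hb⟩ := Ideal.mem_span_singleton.mp (Ideal.Quotient.eq_zero_iff_mem.mp h3)
  have h4 : (t : L) ^ d * ((φ : L) * D t) = φ * b := by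
    simpa using congrArg (fun z : OL => (z : L)) hb
  have h5 : ((δ + 0 : ℤ) : WithTop ℤ) ≤ w ((φ : L) * b) :=
    w.coe_le_mul hφ.ge ((hOL _).mp b.2)
  rw [← h4, w.map_mul, w.map_mul, hφ, hDt, w.pow_eq_coe ht, ← WithTop.coe_add, ← WithTop.coe_add,
    WithTop.coe_le_coe] at h5
  omega

end Different

end AddValuation

theorem LaurentSeries.exists_coe_powerSeries_eq {k : Type*} [Field k] {f : LaurentSeries k}
    (hf : 0 ≤ f.order) : ∃ g : PowerSeries k, algebraMap (PowerSeries k) (LaurentSeries k) g = f := by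
  obtain ⟨n, hn⟩ := Int.eq_ofNat_of_zero_le hf
  refine ⟨PowerSeries.X ^ n * f.powerSeriesPart, ?_⟩
  exact LaurentSeries.X_order_mul_powerSeriesPart hn.symm

theorem LaurentSeries.zero_le_order_coe {k : Type*} [Field k] (g : PowerSeries k) :
    0 ≤ (algebraMap (PowerSeries k) (LaurentSeries k) g).order := by
  by_cases h0 : algebraMap (PowerSeries k) (LaurentSeries k) g = 0
  · rw [h0, HahnSeries.order_zero]
  · by_contra! h
    refine HahnSeries.coeff_order_eq_zero.not.mpr h0 ?_
    exact (PowerSeries.coeff_coe g _).trans (if_pos h)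

/-- A derivation over any base ring, seen as a derivation over `ℤ`. -/
def Derivation.toInt {R A : Type*} [CommRing R] [CommRing A] [Algebra R A] (D : Derivation R A A) :
    Derivation ℤ A A where
  toLinearMap := (D : A →+ A).toIntLinearMap
  map_one_eq_zero' := by simp
  leibniz' a b := by simp

theorem LaurentSeries.exists_derivation {k K : Type*} [Field k] [Field K]
    (ι : K ≃+* LaurentSeries k) :
    ∃ D : Derivation ℤ K K, D (ι.symm (HahnSeries.single 1 1)) = 1 ∧
      ∀ x, 0 ≤ (ι x).order → 0 ≤ (ι (D x)).order := by
  let c : PowerSeries k →+* K :=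
    (ι.symm : LaurentSeries k →+* K).comp (algebraMap (PowerSeries k) (LaurentSeries k))
  let _ : Algebra (PowerSeries k) K := c.toAlgebra
  have hc (g : PowerSeries k) : algebraMap (PowerSeries k) K g =
      ι.symm (algebraMap (PowerSeries k) (LaurentSeries k) g) := rfl
  let e : LaurentSeries k ≃ₐ[PowerSeries k] K := { ι.symm with commutes' := fun g => rfl }
  have hloc : IsLocalization (Submonoid.powers (PowerSeries.X : PowerSeries k)) K :=
    IsLocalization.isLocalization_of_algEquiv _ e
  have hetale : Algebra.FormallyEtale (PowerSeries k) K :=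
    Algebra.FormallyEtale.of_isLocalization (Submonoid.powers (PowerSeries.X : PowerSeries k))
  obtain ⟨D, hD⟩ := Derivation.exists_extension_of_formallyEtale (T := K)
    (PowerSeries.derivative k).toInt
  refine ⟨D, ?_, fun x hx => ?_⟩
  · have h := hD PowerSeries.X
    rw [hc, LaurentSeries.coe_algebraMap, HahnSeries.ofPowerSeries_X] at h
    rw [h]
    exact (congrArg (algebraMap (PowerSeries k) K) PowerSeries.derivative_X).trans (map_one _)
  · obtain ⟨g, hg⟩ := LaurentSeries.exists_coe_powerSeries_eq hx
    rw [← ι.symm_apply_apply x, ← hg, ← hc, hD, hc, RingEquiv.apply_symm_apply]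
    exact LaurentSeries.zero_le_order_coe _

namespace AddValuation

theorem exists_derivation {k K L : Type*} [Field k] [Field K] [Field L] [Algebra K L]
    [Algebra.IsSeparable K L] (ι : K ≃+* LaurentSeries k) (w : AddValuation L (WithTop ℤ)) {N : ℕ}
    (hN : 0 < N)
    (hw : ∀ x : K, x ≠ 0 → w (algebraMap K L x) = ((N * (ι x).order : ℤ) : WithTop ℤ)) :
    ∃ D : Derivation ℤ L L,
      (∀ x : K, 0 ≤ w (algebraMap K L x) → 0 ≤ w (D (algebraMap K L x))) ∧
      ∀ {p : ℕ} [Fact p.Prime] [CharP L p] (x : K) (a : ℤ),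
        w (algebraMap K L x) = ((N * a : ℤ) : WithTop ℤ) → ¬ (p : ℤ) ∣ a →
          w (D (algebraMap K L x)) = ((N * (a - 1) : ℤ) : WithTop ℤ) := by
  obtain ⟨d, hd1, hd0⟩ := LaurentSeries.exists_derivation ι
  have : Algebra.FormallyEtale K L := Algebra.FormallyEtale.of_isSeparable K L
  obtain ⟨D, hD⟩ := Derivation.exists_extension_of_formallyEtale (T := L) d
  have hN' : (0 : ℤ) < N := by exact_mod_cast hN
  have hnonneg (x : K) : 0 ≤ w (algebraMap K L x) ↔ 0 ≤ (ι x).order := by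
    by_cases hx : x = 0
    · simp [hx]
    · rw [hw x hx, ← WithTop.coe_zero, WithTop.coe_le_coe, mul_nonneg_iff_of_pos_left hN']
  have hD0 (x : K) (hx : 0 ≤ w (algebraMap K L x)) : 0 ≤ w (D (algebraMap K L x)) := by
    rw [hD, hnonneg]
    exact hd0 _ ((hnonneg x).mp hx)
  refine ⟨D, hD0, fun {p} _ _ x a hx ha => ?_⟩
  let s : K := ι.symm (HahnSeries.single 1 1)
  have hιs : ι s = HahnSeries.single 1 1 := ι.apply_symm_apply _
  have hs0 : s ≠ 0 := by
    intro h
    rw [h, _root_.map_zero] at hιs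
    exact HahnSeries.single_ne_zero one_ne_zero hιs.symm
  have hws : w (algebraMap K L s) = ((N : ℤ) : WithTop ℤ) := by
    rw [hw s hs0, hιs, HahnSeries.order_single one_ne_zero, mul_one]
  have hDs : D (algebraMap K L s) = 1 := by
    rw [hD, hd1, _root_.map_one]
  have hε : w (algebraMap K L (s ^ (-a) * x)) = ((0 : ℤ) : WithTop ℤ) := by
    rw [_root_.map_mul, map_zpow₀, w.map_mul, w.zpow_eq_coe hws, hx, ← WithTop.coe_add]
    congr 1
    ring
  have hx' : algebraMap K L x = algebraMap K L s ^ a * algebraMap K L (s ^ (-a) * x) := by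
    rw [← map_zpow₀, ← _root_.map_mul, ← mul_assoc, ← zpow_add₀ hs0, add_neg_cancel, zpow_zero,
      one_mul]
  have h1 : w ((a : L) * (algebraMap K L s ^ (a - 1) * (algebraMap K L (s ^ (-a) * x) * 1))) =
      ((N * (a - 1) : ℤ) : WithTop ℤ) := by
    rw [w.map_mul, w.map_mul, mul_one, w.map_intCast_eq_zero ha, w.zpow_eq_coe hws, hε,
      ← WithTop.coe_add, ← WithTop.coe_add]
    congr 1
    ring
  rw [hx', deriv_zpow_mul, hDs, w.map_add_eq_of_lt_right, h1]
  rw [h1]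
  refine lt_of_lt_of_le ?_ (w.coe_le_mul (b := 0) (w.zpow_eq_coe hws a).ge (hD0 _ hε.ge))
  rw [WithTop.coe_lt_coe]
  nlinarith

end AddValuation

namespace AddValuation

section Residue

variable {k K L : Type*} [Field k] [Field K] [Field L] [Algebra K L] (ι : K ≃+* LaurentSeries k)
  (w : AddValuation L (WithTop ℤ)) {N : ℕ} (hN0 : 0 < N)
  (hw : ∀ x : K, x ≠ 0 → w (algebraMap K L x) = ((N * (ι x).order : ℤ) : WithTop ℤ))

include hN0 hw

theorem exists_lt_algebraMap_sub_pow (p : ℕ) [Fact p.Prime] [CharP k p] [PerfectField k] {c : K}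
    (hc : w (algebraMap K L c) = ((0 : ℤ) : WithTop ℤ)) :
    ∃ e : K, w (algebraMap K L e) = ((0 : ℤ) : WithTop ℤ) ∧
      ((0 : ℤ) : WithTop ℤ) < w (algebraMap K L (c - e ^ p)) := by
  have hN' : (0 : ℤ) < N := by exact_mod_cast hN0
  have hc0 : c ≠ 0 := by
    rintro rfl
    simp at hc
  have hord : (ι c).order = 0 := by
    rw [hw c hc0, WithTop.coe_eq_coe] at hc
    exact (mul_eq_zero.mp hc).resolve_left hN'.ne'
  have hcoeff : (ι c).coeff 0 ≠ 0 := by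
    rw [← hord]
    exact HahnSeries.coeff_order_eq_zero.not.mpr (by simpa using hc0)
  have : ExpChar k p := ExpChar.prime Fact.out
  obtain ⟨β, hβ⟩ := surjective_frobenius k p ((ι c).coeff 0)
  rw [frobenius_def] at hβ
  have hβ0 : β ≠ 0 := by
    rintro rfl
    rw [zero_pow (Fact.out : p.Prime).ne_zero] at hβ
    exact hcoeff hβ.symm
  have he0 : ι.symm (HahnSeries.C β) ≠ 0 := by simpa using hβ0
  refine ⟨ι.symm (HahnSeries.C β), ?_, ?_⟩
  · rw [hw _ he0, RingEquiv.apply_symm_apply, HahnSeries.order_C, mul_zero]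
  · by_cases hz : c - ι.symm (HahnSeries.C β) ^ p = 0
    · rw [hz, _root_.map_zero, w.map_zero]
      exact WithTop.coe_lt_top _
    · rw [hw _ hz, WithTop.coe_lt_coe]
      refine mul_pos hN' ?_
      have hz' : ι (c - ι.symm (HahnSeries.C β) ^ p) ≠ 0 :=
        (map_ne_zero_iff ι ι.injective).mpr hz
      have heq : ι (c - ι.symm (HahnSeries.C β) ^ p) = ι c - HahnSeries.C ((ι c).coeff 0) := by
        rw [_root_.map_sub, _root_.map_pow, RingEquiv.apply_symm_apply, ← _root_.map_pow, hβ]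
      by_contra! hle
      refine HahnSeries.coeff_order_eq_zero.not.mpr hz' ?_
      rw [heq] at hle ⊢
      generalize (ι c - HahnSeries.C ((ι c).coeff 0)).order = m at hle ⊢
      rw [HahnSeries.coeff_sub]
      rcases hle.lt_or_eq with h | rfl
      · rw [HahnSeries.coeff_eq_zero_of_lt_order (hord ▸ h), HahnSeries.C_apply,
          HahnSeries.coeff_single_of_ne h.ne, sub_zero]
      · rw [HahnSeries.C_apply, HahnSeries.coeff_single_same, sub_self]

theorem exists_lt_sub_pow {t : L} (ht : w t = ((1 : ℤ) : WithTop ℤ)) [FiniteDimensional K L]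
    (hN : Module.finrank K L = N) (p : ℕ) [Fact p.Prime] [CharP k p] [PerfectField k]
    {f : L} {M : ℤ} (hf : w f = ((p * M : ℤ) : WithTop ℤ)) :
    ∃ h : L, w h = (M : WithTop ℤ) ∧ w f < w (f - h ^ p) := by
  have hK : ∀ x : K, x ≠ 0 → ∃ a : ℤ, w (algebraMap K L x) = ((N * a : ℤ) : WithTop ℤ) :=
    fun x hx => ⟨_, hw x hx⟩
  obtain ⟨ε, hε, hfε⟩ := w.exists_eq_zpow_mul ht hf
  obtain ⟨c, hc⟩ := w.exists_eq_sum_algebraMap_mul_pow hK ht hN ε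
  have hpos : ((0 : ℤ) : WithTop ℤ) < w (ε - algebraMap K L (c 0)) := by
    have h0 : ε - algebraMap K L (c 0) =
        ∑ i ∈ (Finset.range N).erase 0, algebraMap K L (c i) * t ^ i := by
      rw [hc, ← Finset.add_sum_erase _ _ (Finset.mem_range.mpr hN0), pow_zero, mul_one,
        add_sub_cancel_left]
    rw [h0]
    refine w.map_lt_sum WithTop.coe_ne_top fun i hi => ?_
    obtain ⟨hne, hi⟩ := Finset.mem_erase.mp hi
    have hi' := Finset.mem_range.mp hi
    have h1 := w.le_algebraMap_mul_pow_of_le_sum hK ht (a := ((0 : ℤ) : WithTop ℤ))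
      (by rw [← hc, hε]) hi'
    have h2 := w.coe_mul_le_algebraMap hK (a := 0) (r := i) (by exact_mod_cast hi')
      (by rw [mul_zero]; exact w.le_algebraMap_of_le_mul_pow ht h1)
    refine lt_of_lt_of_le ?_ (w.coe_le_mul h2 (w.pow_eq_coe ht i).ge)
    rw [WithTop.coe_lt_coe]
    omega
  have hc0 : w (algebraMap K L (c 0)) = ((0 : ℤ) : WithTop ℤ) := by
    rw [← sub_sub_cancel ε (algebraMap K L (c 0)), w.map_sub_eq_of_lt_left, hε]
    rwa [hε]
  obtain ⟨e, he, hlt⟩ := w.exists_lt_algebraMap_sub_pow ι hN0 hw p hc0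
  refine ⟨t ^ M * algebraMap K L e, ?_, ?_⟩
  · rw [w.map_mul, w.zpow_eq_coe ht, he, ← WithTop.coe_add]
    congr 1
    ring
  · have h3 : f - (t ^ M * algebraMap K L e) ^ p = t ^ (p * M : ℤ) *
        ((ε - algebraMap K L (c 0)) + algebraMap K L (c 0 - e ^ p)) := by
      rw [hfε, mul_pow, mul_comm (p : ℤ), zpow_mul, zpow_natCast, _root_.map_sub, _root_.map_pow]
      ring
    have h4 := w.map_lt_add hpos hlt
    rw [h3, w.map_mul, w.zpow_eq_coe ht, mul_one, hf]
    calc ((p * M : ℤ) : WithTop ℤ) = ((p * M : ℤ) : WithTop ℤ) + ((0 : ℤ) : WithTop ℤ) := by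
          rw [← WithTop.coe_add, add_zero]
      _ < _ := WithTop.add_lt_add_left WithTop.coe_ne_top h4

theorem exists_sub_artinSchreier_eq {t : L} (ht : w t = ((1 : ℤ) : WithTop ℤ))
    [FiniteDimensional K L] (hN : Module.finrank K L = N) (p : ℕ) [Fact p.Prime] [CharP k p]
    [CharP L p] [PerfectField k] (D : Derivation ℤ L L)
    (hD0 : ∀ x : K, 0 ≤ w (algebraMap K L x) → 0 ≤ w (D (algebraMap K L x))) {δ : ℕ}
    (hDt : w (D t) = ((-δ : ℤ) : WithTop ℤ)) {f : L} {A : ℤ}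
    (hDf : w (D f) = ((A - 1 - δ : ℤ) : WithTop ℤ)) (hA : ((p * A : ℤ) : WithTop ℤ) < w f) :
    ∃ h : L, w (f - (h ^ p - h)) = (A : WithTop ℤ) := by
  have hK : ∀ x : K, x ≠ 0 → ∃ a : ℤ, w (algebraMap K L x) = ((N * a : ℤ) : WithTop ℤ) :=
    fun x hx => ⟨_, hw x hx⟩
  have hp : (1 : ℤ) < p := by exact_mod_cast (Fact.out : p.Prime).one_lt
  have key (m : ℕ) : ∀ f : L, w (D f) = ((A - 1 - δ : ℤ) : WithTop ℤ) →
      ((p * A : ℤ) : WithTop ℤ) < w f → ((A - m : ℤ) : WithTop ℤ) ≤ w f →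
        ∃ h : L, w (f - (h ^ p - h)) = (A : WithTop ℤ) := by
    induction m with
    | zero =>
      intro f hDf hA hm
      have hf0 : f ≠ 0 := by
        rintro rfl
        rw [_root_.map_zero, w.map_zero] at hDf
        exact WithTop.coe_ne_top hDf.symm
      obtain ⟨a, ha⟩ := w.exists_eq_coe hf0
      have h1 := w.le_deriv hK ht D hD0 hN hDt ha
      rw [hDf, WithTop.coe_le_coe] at h1
      rw [ha, WithTop.coe_le_coe] at hm
      push_cast at hm
      refine ⟨0, ?_⟩
      rw [zero_pow (Fact.out : p.Prime).ne_zero, sub_zero, sub_zero, ha, WithTop.coe_eq_coe]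
      omega
    | succ m ih =>
      intro f hDf hA hm
      have hf0 : f ≠ 0 := by
        rintro rfl
        rw [_root_.map_zero, w.map_zero] at hDf
        exact WithTop.coe_ne_top hDf.symm
      obtain ⟨a, ha⟩ := w.exists_eq_coe hf0
      have h1 := w.le_deriv hK ht D hD0 hN hDt ha
      rw [hDf, WithTop.coe_le_coe] at h1
      by_cases hdvd : (p : ℤ) ∣ a
      · obtain ⟨M, rfl⟩ := hdvd
        obtain ⟨g, hg, hlt⟩ := w.exists_lt_sub_pow ι hN0 hw ht hN p ha
        rw [ha, WithTop.coe_lt_coe] at hA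
        have hAM : A < M := lt_of_mul_lt_mul_left hA (by omega)
        have hDg := w.le_deriv hK ht D hD0 hN hDt hg
        have hD' : D (f - g ^ p + g) = D f + D g := by
          rw [_root_.map_add, _root_.map_sub, D.leibniz_pow, nsmul_eq_mul, CharP.cast_eq_zero,
            zero_mul, sub_zero]
        have hw' : ((p * M : ℤ) : WithTop ℤ) < w (f - g ^ p + g) := by
          refine w.map_lt_add (ha ▸ hlt) ?_
          rw [hg, WithTop.coe_lt_coe]
          omega
        obtain ⟨h, hh⟩ := ih (f - g ^ p + g) (by
          rw [hD', w.map_add_eq_of_lt_left, hDf]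
          refine lt_of_lt_of_le ?_ hDg
          rw [hDf, WithTop.coe_lt_coe]
          omega) (lt_trans (by rwa [WithTop.coe_lt_coe]) hw') (by
          rw [ha, WithTop.coe_le_coe] at hm
          by_cases hz : f - g ^ p + g = 0
          · rw [hz, w.map_zero]
            exact le_top
          · obtain ⟨b, hb⟩ := w.exists_eq_coe hz
            rw [hb, WithTop.coe_lt_coe] at hw'
            rw [hb, WithTop.coe_le_coe]
            push_cast at hm
            omega)
        refine ⟨g + h, ?_⟩
        rw [← hh, add_pow_char]
        congr 1
        ring
      · have h2 := w.deriv_eq hK ht D hD0 hN hDt ha hdvd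
        rw [hDf, WithTop.coe_eq_coe] at h2
        refine ⟨0, ?_⟩
        rw [zero_pow (Fact.out : p.Prime).ne_zero, sub_zero, sub_zero, ha, WithTop.coe_eq_coe]
        omega
  have hf0 : f ≠ 0 := by
    rintro rfl
    rw [_root_.map_zero, w.map_zero] at hDf
    exact WithTop.coe_ne_top hDf.symm
  obtain ⟨a, ha⟩ := w.exists_eq_coe hf0
  refine key (A - a).toNat f hDf hA ?_
  rw [ha, WithTop.coe_le_coe]
  omega

end Residue

end AddValuation

namespace WittVector

variable {p : ℕ} [Fact p.Prime]

theorem pow_sub_mem_adjoin_of_frobenius_eq_add {K L : Type*} [Field K] [Field L] [Algebra K L]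
    [CharP L p] {x u : WittVector p L} (hF : frobenius x = x + u) {n : ℕ}
    (hu : ∀ i < n, u.coeff i ∈ (algebraMap K L).fieldRange) {l : ℕ} (hl : l < n) :
    x.coeff l ^ p - x.coeff l ∈ IntermediateField.adjoin K (x.coeff '' Set.Iio l) := by
  have hK (i : ℕ) (hi : i < n) : u.coeff i ∈ IntermediateField.adjoin K (x.coeff '' Set.Iio l) := by
    obtain ⟨c, hc⟩ := hu i hi
    rw [← hc]
    exact IntermediateField.algebraMap_mem _ c
  rw [coeff_pow_eq_of_frobenius_eq_add hF, add_sub_cancel_left]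
  refine add_mem (hK l hl) (add_coeff_mem
    (IntermediateField.adjoin K (x.coeff '' Set.Iio l)).toSubring (fun i => ?_) (fun i => ?_) l)
  · rw [coeff_init]
    split_ifs with h
    · exact IntermediateField.subset_adjoin _ _ ⟨i, h, rfl⟩
    · exact zero_mem _
  · rw [coeff_init]
    split_ifs with h
    · exact hK i (h.trans hl)
    · exact zero_mem _

end WittVector

namespace AddValuation

variable {p : ℕ} [Fact p.Prime]

theorem le_of_artinSchreier_tower {K L : Type*} [Field K] [Field L] [Algebra K L] [CharP L p]
    [FiniteDimensional K L] [Algebra.IsSeparable K L] (w : AddValuation L (WithTop ℤ)) {n : ℕ}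
    (hK : ∀ x : K, x ≠ 0 → ∃ a : ℤ,
      w (algebraMap K L x) = (((p ^ n : ℕ) * a : ℤ) : WithTop ℤ))
    {t : L} (ht : w t = ((1 : ℤ) : WithTop ℤ)) (hN : Module.finrank K L = p ^ n) {δ : ℤ}
    (hδ : w (Polynomial.aeval t (Polynomial.derivative (minpoly K t))) = (δ : WithTop ℤ))
    {x : ℕ → L} (hx : ∀ l < n, x l ^ p - x l ∈ IntermediateField.adjoin K (x '' Set.Iio l))
    (htop : IntermediateField.adjoin K (x '' Set.Iio n) = ⊤) {m : ℕ}
    (hm : ∀ l < n, ((-(p ^ l * m) : ℤ) : WithTop ℤ) ≤ w (x l)) :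
    δ ≤ p ^ n - 1 + (p ^ n - 1) * m := by
  have hp := (Fact.out : p.Prime).one_le
  have hprod (l : ℕ) (hl : l ≤ n) : ((-((p ^ l - 1) * m) : ℤ) : WithTop ℤ) ≤
      w (∏ i ∈ Finset.range l, x i ^ (p - 1)) := by
    induction l with
    | zero => simp
    | succ l ih =>
      rw [Finset.prod_range_succ]
      refine le_trans (le_of_eq ?_) (w.coe_le_mul (ih (by omega))
        (w.coe_le_pow (hm l (by omega)) (p - 1)))
      congr 1
      push_cast [hp]
      ring
  by_contra! hlt
  have h := w.le_algebraMap_trace hK ht hN hδ (a := 1)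
    (z := ∏ i ∈ Finset.range n, x i ^ (p - 1)) (le_trans (by
      rw [WithTop.coe_le_coe]
      push_cast
      linarith) (hprod n le_rfl))
  rw [trace_prod_pow_of_artinSchreier_tower hx htop hN, _root_.map_pow, _root_.map_neg,
    _root_.map_one, w.map_pow, w.map_neg, w.map_one, nsmul_zero, ← WithTop.coe_zero,
    WithTop.coe_le_coe, mul_one] at h
  have : 0 < p ^ n := by positivity
  omega

theorem exists_sub_artinSchreier_eq_of_wittVector {k K L : Type*} [Field k] [Field K] [Field L]
    [Algebra K L] [CharP k p] [CharP L p] [PerfectField k] [FiniteDimensional K L]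
    [Algebra.IsSeparable K L] (ι : K ≃+* LaurentSeries k) (w : AddValuation L (WithTop ℤ)) {n : ℕ}
    (hw : ∀ x : K, x ≠ 0 →
      w (algebraMap K L x) = (((p ^ n : ℕ) * (ι x).order : ℤ) : WithTop ℤ))
    {t : L} (ht : w t = ((1 : ℤ) : WithTop ℤ)) (hN : Module.finrank K L = p ^ n)
    {x u : WittVector p L} (hF : WittVector.frobenius x = x + u)
    {ν : ℕ → ℕ} (hν : ∀ i < n, 0 < ν i ∧ ¬ p ∣ ν i)
    (hu : ∀ i < n, ∃ c : K, c ≠ 0 ∧ u.coeff i = algebraMap K L c ∧ (ι c).order = -(ν i : ℤ))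
    (htop : IntermediateField.adjoin K (x.coeff '' Set.Iio n) = ⊤) {j : ℕ} (hj : j < n)
    (hlt : ∀ i < n, i ≠ j → p ^ (n - 1 - i) * ν i < p ^ (n - 1 - j) * ν j)
    (D : Derivation ℤ L L)
    (hD0 : ∀ x : K, 0 ≤ w (algebraMap K L x) → 0 ≤ w (D (algebraMap K L x)))
    (hD1 : ∀ (x : K) (a : ℤ), w (algebraMap K L x) = (((p ^ n : ℕ) * a : ℤ) : WithTop ℤ) →
      ¬ (p : ℤ) ∣ a → w (D (algebraMap K L x)) = (((p ^ n : ℕ) * (a - 1) : ℤ) : WithTop ℤ))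
    {δ : ℕ}
    (hδ : w (Polynomial.aeval t (Polynomial.derivative (minpoly K t))) = ((δ : ℤ) : WithTop ℤ))
    (hDt : w (D t) = ((-δ : ℤ) : WithTop ℤ)) :
    ∃ h : L, w (x.coeff j ^ (p * (p ^ (n - j) - 1) + 1) - (h ^ p - h)) =
      ((-(p ^ (2 * n - j) * ν j - (δ - p ^ n + 1)) : ℤ) : WithTop ℤ) := by
  have hp := (Fact.out : p.Prime)
  have hK : ∀ x : K, x ≠ 0 → ∃ a : ℤ, w (algebraMap K L x) =
      (((p ^ n : ℕ) * a : ℤ) : WithTop ℤ) := fun x hx => ⟨_, hw x hx⟩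
  have hpn : 0 < p ^ n := pow_pos hp.pos n
  obtain ⟨m, hm⟩ : ∃ m, m = p ^ (n - 1 - j) * ν j := ⟨_, rfl⟩
  have hm0 : 0 < m := hm ▸ mul_pos (pow_pos hp.pos _) (hν j hj).1
  have hpow (i : ℕ) (hi : i < n) : (p : ℤ) ^ n * ν i = p ^ (i + 1) * (p ^ (n - 1 - i) * ν i : ℕ) := by
    push_cast
    rw [← mul_assoc, ← pow_add]
    congr 2
    omega
  have hwu (i : ℕ) (hi : i < n) :
      w (u.coeff i) = ((-(p ^ (i + 1) * (p ^ (n - 1 - i) * ν i : ℕ)) : ℤ) : WithTop ℤ) := by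
    obtain ⟨c, hc0, hc, hord⟩ := hu i hi
    rw [hc, hw c hc0, hord, ← hpow i hi, WithTop.coe_eq_coe]
    push_cast
    ring
  have hwDu (i : ℕ) (hi : i < n) : w (D (u.coeff i)) =
      ((-(p ^ (i + 1) * (p ^ (n - 1 - i) * ν i : ℕ) + (p ^ n : ℕ)) : ℤ) : WithTop ℤ) := by
    obtain ⟨c, hc0, hc, hord⟩ := hu i hi
    rw [hc, hD1 c (-(ν i : ℤ)) (by rw [hw c hc0, hord])
      (by rw [Int.dvd_neg, Int.natCast_dvd_natCast]; exact (hν i hi).2), ← hpow i hi,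
      WithTop.coe_eq_coe]
    push_cast
    ring
  have hle (i : ℕ) (hi : i < n) : p ^ (n - 1 - i) * ν i ≤ m := by
    by_cases hij : i = j
    · rw [hm, hij]
    · exact hm ▸ (hlt i hi hij).le
  have hle' (i : ℕ) (hi : i < j) : p ^ (n - 1 - i) * ν i ≤ m - 1 := by
    have := hlt i (hi.trans hj) hi.ne
    omega
  have hmul {a b : ℕ} (i : ℕ) (hab : a ≤ b) : (p : ℤ) ^ (i + 1) * a ≤ p ^ (i + 1) * b := by
    exact_mod_cast Nat.mul_le_mul_left _ hab
  have hx := WittVector.le_addValuation_coeff_of_frobenius_eq_add w hF ht m (N := n) fun l hl => by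
    rw [hwu l hl, WithTop.coe_le_coe, neg_le_neg_iff]
    exact hmul l (hle l hl)
  have hul (l : ℕ) (hl : l < j) :
      ((-(p ^ (l + 1) * (m - 1 : ℕ)) : ℤ) : WithTop ℤ) ≤ w (u.coeff l) := by
    rw [hwu l (hl.trans hj), WithTop.coe_le_coe, neg_le_neg_iff]
    exact hmul l (hle' l hl)
  have hDul (l : ℕ) (hl : l < j) :
      ((-(p ^ (l + 1) * (m - 1 : ℕ) + (p ^ n : ℕ)) : ℤ) : WithTop ℤ) ≤ w (D (u.coeff l)) := by
    rw [hwDu l (hl.trans hj), WithTop.coe_le_coe, neg_le_neg_iff]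
    exact add_le_add_left (hmul l (hle' l hl)) _
  have hxj := WittVector.addValuation_coeff_of_frobenius_eq_add w hF ht
    (Nat.sub_lt hm0 one_pos) hul (by rw [hwu j hj, hm])
  have hDxj := WittVector.addValuation_deriv_coeff w hF D ht
    (Nat.sub_lt hm0 one_pos) hul hDul (by rw [hwDu j hj, hm])
  have hδle := w.le_of_artinSchreier_tower hK ht hN hδ (x := x.coeff)
    (fun l hl => WittVector.pow_sub_mem_adjoin_of_frobenius_eq_add hF
      (fun i hi => by obtain ⟨c, -, hc, -⟩ := hu i hi; exact ⟨c, hc.symm⟩) hl) htop hx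
  have hpq : (p : ℤ) ^ j * p ^ (n - j) = p ^ n := by
    rw [← pow_add]
    congr 1
    omega
  have hmain : (p : ℤ) ^ (2 * n - j) * ν j = p * p ^ n * m := by
    have h : 2 * n - j = 1 + n + (n - 1 - j) := by omega
    rw [hm, h, pow_add, pow_add]
    push_cast
    ring
  obtain ⟨E, hE⟩ : ∃ E, E = p * (p ^ (n - j) - 1) := ⟨_, rfl⟩
  have hEz : (E : ℤ) = p * (p ^ (n - j) - 1) := by
    rw [hE]
    push_cast [Nat.one_le_pow (n - j) p hp.pos]
    ring
  have hEL : ((E + 1 : ℕ) : L) = 1 := by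
    rw [hE]
    push_cast
    rw [CharP.cast_eq_zero, zero_mul, zero_add]
  rw [← hE, hmain]
  refine w.exists_sub_artinSchreier_eq ι hpn hw ht hN p D hD0 hDt ?_ ?_
  · rw [D.leibniz_pow, nsmul_eq_mul, hEL, one_mul, smul_eq_mul, add_tsub_cancel_right, w.map_mul,
      w.pow_eq_coe hxj, hDxj, ← WithTop.coe_add, WithTop.coe_eq_coe, hEz]
    push_cast
    linear_combination (-(p : ℤ) * m) * hpq
  · rw [w.pow_eq_coe hxj, WithTop.coe_lt_coe]
    push_cast
    rw [hEz]
    have hp2 : (2 : ℤ) ≤ p := by exact_mod_cast hp.two_le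
    have h1 : (p : ℤ) * (δ - p ^ n + 1) ≤ p * ((p ^ n - 1) * m) :=
      mul_le_mul_of_nonneg_left (by linarith) (by omega)
    have h2 : 0 < (m : ℤ) * (p * p ^ n * (p - 2) + p + (p - 1) * p ^ j) := by
      refine mul_pos (by omega) (add_pos_of_pos_of_nonneg (add_pos_of_nonneg_of_pos ?_ ?_) ?_)
      · exact mul_nonneg (by positivity) (by omega)
      · omega
      · exact mul_nonneg (by omega) (by positivity)
    linear_combination h1 + h2 + (p : ℤ) * m * hpq

end AddValuation

theorem exists_wittVector_frobenius_eq_add {p : ℕ} [Fact p.Prime] {n : ℕ} {L Ω : Type*} [Field L]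
    [Field Ω] [CharP L p] [CharP Ω p] (φ : L →+* Ω) (y u : TruncatedWittVector p (n + 1) Ω)
    (hy : twFrobenius p (n + 1) y - y = u) (x : ℕ → L)
    (hx : ∀ i : Fin (n + 1), i.val < n → φ (x i) = y.coeff i) :
    ∃ v : WittVector p L, WittVector.frobenius (WittVector.mk p x) = WittVector.mk p x + v ∧
      ∀ i : Fin (n + 1), i.val < n → φ (v.coeff i) = u.coeff i := by
  refine ⟨WittVector.frobenius (WittVector.mk p x) - WittVector.mk p x, by ring, fun i hi => ?_⟩
  have hout : WittVector.truncate (n + 1) (WittVector.frobenius y.out - y.out) = u := by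
    rw [← hy, map_sub]
    congr 1
    · ext l
      rw [WittVector.coeff_truncate, WittVector.coeff_frobenius_charP, TruncatedWittVector.coeff_out,
        twFrobenius, TruncatedWittVector.coeff_mk]
    · exact TruncatedWittVector.truncateFun_out y
  have htr : WittVector.truncate n (WittVector.map φ (WittVector.mk p x)) =
      WittVector.truncate n y.out := by
    ext l
    rw [WittVector.coeff_truncate, WittVector.coeff_truncate, WittVector.map_coeff]
    have := TruncatedWittVector.coeff_out y ⟨l, by omega⟩
    rw [this]
    exact hx ⟨l, by omega⟩ l.isLt
  have htrF : WittVector.truncate n (WittVector.frobenius (WittVector.map φ (WittVector.mk p x))) =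
      WittVector.truncate n (WittVector.frobenius y.out) := by
    ext l
    have := congrArg (fun z => z.coeff l) htr
    simp only [WittVector.coeff_truncate] at this
    rw [WittVector.coeff_truncate, WittVector.coeff_truncate, WittVector.coeff_frobenius_charP,
      WittVector.coeff_frobenius_charP, this]
  have hsub : WittVector.truncate n
      (WittVector.map φ (WittVector.frobenius (WittVector.mk p x) - WittVector.mk p x)) =
      WittVector.truncate n (WittVector.frobenius y.out - y.out) := by
    rw [map_sub, map_sub, map_sub, htr, ← htrF]
    congr 2
    ext l
    rw [WittVector.map_coeff, WittVector.coeff_frobenius_charP, WittVector.coeff_frobenius_charP,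
      WittVector.map_coeff, map_pow]
  have h := congrArg (fun z => z.coeff ⟨i, hi⟩) hsub
  simp only [WittVector.coeff_truncate, WittVector.map_coeff] at h
  rw [h, ← hout, WittVector.coeff_truncate]

/-- In the Artin–Schreier–Witt tower setting of length `n+1` (with `n ≥ 1`),
let `m_n = max_{0≤i≤n−1} p^{n−1−i} ν_i`, let `μ_n = deg𝔇_{L_n/K} − p^n + 1`, and let `j` be
the unique index in `{0,…,n−1}` with `p^{n−1−j} ν_j = m_n` (unique because the `ν_i` are
prime to `p`). Then there is `h ∈ L_n` with
`v_{L_n}(y_j^{p(p^{n−j}−1)+1} − (h^p − h)) = −(p^{2n−j}·ν_j − μ_n)`. -/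
theorem asw_dominant_monomial_valuation (p : ℕ) [Fact p.Prime] (k : Type*) [Field k] [CharP k p]
    [PerfectField k] (n : ℕ) (hn : 1 ≤ n)
    -- `K` is the field `k((s))` of Laurent series over `k`, with valuation `v_K = order ∘ ι`
    (K : Type*) [Field K] (ι : K ≃+* LaurentSeries k)
    -- the Witt vector `u` of length `n+1` over `K`, with pole orders `ν_i` prime to `p`
    (u : TruncatedWittVector p (n + 1) K)
    (ν : ℕ → ℕ) (hν : ∀ i ≤ n, 0 < ν i ∧ ¬ p ∣ ν i)
    (hu : ∀ i : Fin (n + 1), u.coeff i ≠ 0)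
    (hord : ∀ i : Fin (n + 1), (ι (u.coeff i)).order = -(ν i.val : ℤ))
    -- a separable closure `Ω` of `K` and a solution `y` of `F(y) − y = u` with entries in `Ω`
    (Ω : Type*) [Field Ω] [Algebra K Ω] [IsSepClosed Ω] [Algebra.IsSeparable K Ω]
    (y : TruncatedWittVector p (n + 1) Ω)
    (hy : twFrobenius p (n + 1) y - y = twMap p (n + 1) (algebraMap K Ω) u)
    -- `L_n = K(y_0, …, y_{n−1})`, cyclic totally ramified of degree `p^n` over `K`
    (Ln : IntermediateField K Ω)
    (hLn : Ln = IntermediateField.adjoin K {x | ∃ i : Fin (n + 1), i.val < n ∧ y.coeff i = x})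
    [IsGalois K ↥Ln] [FiniteDimensional K ↥Ln] [IsCyclic (↥Ln ≃ₐ[K] ↥Ln)]
    (hdeg : Module.finrank K ↥Ln = p ^ n)
    -- the normalized valuation `v_{L_n}` of `L_n`
    (v : ↥Ln → WithTop ℤ) (hv : IsAddValuation v)
    (hvK : ∀ x : K, x ≠ 0 →
      v (algebraMap K ↥Ln x) = ((p ^ n * (ι x).order : ℤ) : WithTop ℤ))
    -- the valuation rings `O_{L_n}` and `O_K` (inside `L_n`), and a uniformizer of `O_{L_n}`
    (OL OK : Subring ↥Ln)
    (hOL : ∀ z, z ∈ OL ↔ 0 ≤ v z)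
    (hOK : ∀ z, z ∈ OK ↔ ∃ x : K, 0 ≤ (ι x).order ∧ algebraMap K ↥Ln x = z)
    (hle : OK ≤ OL)
    (t : ↥OL) (ht : v (t : ↥Ln) = 1)
    -- `d = deg𝔇_{L_n/K}`: the different `Ann(Ω¹_{O_{L_n}/O_K})` is the `d`-th power of the
    -- maximal ideal of `O_{L_n}`, and `μ_n = d − p^n + 1`
    (d : ℕ)
    (hd : letI := (Subring.inclusion hle).toAlgebra;
      Module.annihilator ↥OL (KaehlerDifferential ↥OK ↥OL) = Ideal.span {t} ^ d)
    (μ : ℤ) (hμ : μ = (d : ℤ) - p ^ n + 1)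
    -- `j` is the unique index with `p^{n−1−j} ν_j = m_n`
    (j : ℕ) (hj : j < n)
    (hjmax : p ^ (n - 1 - j) * ν j = (Finset.range n).sup fun i => p ^ (n - 1 - i) * ν i)
    (hjuniq : ∀ i < n,
      (p ^ (n - 1 - i) * ν i = (Finset.range n).sup fun l => p ^ (n - 1 - l) * ν l) → i = j)
    -- `y_j` lies in `L_n`
    (hyj : y.coeff (⟨j, by omega⟩ : Fin (n + 1)) ∈ Ln) :
    ∃ h : ↥Ln,
      v ((⟨y.coeff (⟨j, by omega⟩ : Fin (n + 1)), hyj⟩ : ↥Ln) ^ (p * (p ^ (n - j) - 1) + 1)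
          - (h ^ p - h)) =
        ((-((p : ℤ) ^ (2 * n - j) * (ν j : ℤ) - μ) : ℤ) : WithTop ℤ) := by
  have hp := (Fact.out : p.Prime)
  have : CharP (LaurentSeries k) p :=
    charP_of_injective_ringHom (HahnSeries.C_injective (Γ := ℤ) (R := k)) p
  have : CharP K p := charP_of_injective_ringHom (f := (ι.symm : LaurentSeries k →+* K))
    ι.symm.injective p
  have : CharP Ln p := charP_of_injective_ringHom (algebraMap K Ln).injective p
  have : CharP Ω p := charP_of_injective_ringHom (algebraMap K Ω).injective p
  obtain ⟨hv0, hvmul, hvadd⟩ := hv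
  have hv1 : v 1 = 0 := by
    have h := hvmul 1 1
    rw [mul_one] at h
    obtain ⟨a, ha⟩ := WithTop.ne_top_iff_exists.mp ((hv0 1).not.mpr one_ne_zero)
    rw [← ha, ← WithTop.coe_add, WithTop.coe_eq_coe] at h
    rw [← ha, ← WithTop.coe_zero, WithTop.coe_eq_coe]
    omega
  let w : AddValuation Ln (WithTop ℤ) := AddValuation.of v ((hv0 0).mpr rfl) hv1 hvadd hvmul
  have hwv (z : Ln) : w z = v z := AddValuation.of_apply ..
  have hwK (x : K) (hx : x ≠ 0) :
      w (algebraMap K Ln x) = (((p ^ n : ℕ) * (ι x).order : ℤ) : WithTop ℤ) := by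
    rw [hwv, hvK x hx]
    push_cast
    rfl
  have hK (x : K) (hx : x ≠ 0) : ∃ a : ℤ,
      w (algebraMap K Ln x) = (((p ^ n : ℕ) * a : ℤ) : WithTop ℤ) := ⟨_, hwK x hx⟩
  have hpn : 0 < p ^ n := pow_pos hp.pos n
  have hwt : w (t : Ln) = ((1 : ℤ) : WithTop ℤ) := by rw [hwv, ht]; rfl
  have hnonneg (x : K) : 0 ≤ w (algebraMap K Ln x) ↔ 0 ≤ (ι x).order := by
    by_cases hx : x = 0
    · simp [hx]
    · rw [hwK x hx, ← WithTop.coe_zero, WithTop.coe_le_coe,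
        mul_nonneg_iff_of_pos_left (by exact_mod_cast hpn)]
  have hOLw (z : Ln) : z ∈ OL ↔ 0 ≤ w z := by rw [hOL, hwv]
  have hOKw (z : Ln) : z ∈ OK ↔ ∃ x : K, 0 ≤ w (algebraMap K Ln x) ∧ algebraMap K Ln x = z := by
    simp only [hOK, hnonneg]
  obtain ⟨D, hD0, hD1⟩ := w.exists_derivation ι hpn hwK
  obtain ⟨δ, hδ⟩ := w.exists_aeval_derivative_minpoly_eq_coe hK hwt hdeg
  have hDt := w.deriv_uniformizer hK hwt D hD0 (fun x hx => by
    have h := hD1 (p := p) x 1 (by rw [mul_one]; exact hx)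
      (by exact_mod_cast hp.one_lt.ne' ∘ Nat.dvd_one.mp)
    simpa using h) hdeg hδ
  have hdδ : d = δ := by
    let _ := (Subring.inclusion hle).toAlgebra
    refine le_antisymm (w.le_of_annihilator_kaehlerDifferential_eq hK hOLw hOKw (fun _ => rfl) hwt
      hdeg hδ hd) ?_
    have hφ : Polynomial.aeval (t : Ln) (Polynomial.derivative (minpoly K (t : Ln))) ∈ OL := by
      rw [hOLw, hδ]
      exact_mod_cast Int.natCast_nonneg δ
    exact w.ge_of_annihilator_kaehlerDifferential_eq hOLw hOKw (fun _ => rfl) hwt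
      (φ := ⟨_, hφ⟩) hδ D hD0 hDt (fun x hx => w.neg_le_deriv_of_nonneg hK hwt D hD0 hdeg hDt hx) hd
  have hmem (i : Fin (n + 1)) (hi : i.val < n) : y.coeff i ∈ Ln := by
    rw [hLn]
    exact IntermediateField.subset_adjoin _ _ ⟨i, hi, rfl⟩
  let x : ℕ → Ln := fun i => if hi : i < n then ⟨y.coeff ⟨i, by omega⟩, hmem ⟨i, by omega⟩ hi⟩ else 0
  have hx (i : Fin (n + 1)) (hi : i.val < n) : algebraMap Ln Ω (x i) = y.coeff i := by
    simp only [x, dif_pos hi]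
    rfl
  obtain ⟨U, hF, hU⟩ := exists_wittVector_frobenius_eq_add (algebraMap Ln Ω) y _ hy x hx
  have hUK (i : ℕ) (hi : i < n) : ∃ c : K, c ≠ 0 ∧ U.coeff i = algebraMap K Ln c ∧
      (ι c).order = -(ν i : ℤ) := by
    refine ⟨u.coeff ⟨i, by omega⟩, hu _, (algebraMap Ln Ω).injective ?_, hord _⟩
    rw [hU ⟨i, by omega⟩ hi, twMap, TruncatedWittVector.coeff_mk, ← IsScalarTower.algebraMap_apply]
  have htop : IntermediateField.adjoin K ((WittVector.mk p x).coeff '' Set.Iio n) = ⊤ := by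
    refine IntermediateField.map_injective Ln.val ?_
    rw [IntermediateField.adjoin_map, ← AlgHom.fieldRange_eq_map, IntermediateField.fieldRange_val]
    conv_rhs => rw [hLn]
    congr 1
    ext z
    simp only [Set.mem_image, Set.mem_Iio, Set.mem_ofPred_eq]
    constructor
    · rintro ⟨_, ⟨i, hi, rfl⟩, rfl⟩
      exact ⟨⟨i, by omega⟩, hi, (hx ⟨i, by omega⟩ hi).symm⟩
    · rintro ⟨i, hi, rfl⟩
      exact ⟨x i, ⟨i, hi, rfl⟩, hx i hi⟩
  have hlt (i : ℕ) (hi : i < n) (hij : i ≠ j) :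
      p ^ (n - 1 - i) * ν i < p ^ (n - 1 - j) * ν j := by
    rw [hjmax]
    exact lt_of_le_of_ne (Finset.le_sup (f := fun i => p ^ (n - 1 - i) * ν i)
      (Finset.mem_range.mpr hi)) fun h => hij (hjuniq i hi h)
  obtain ⟨h, hh⟩ := w.exists_sub_artinSchreier_eq_of_wittVector ι hwK hwt hdeg hF
    (fun i hi => hν i hi.le) hUK htop hj hlt D hD0 (fun x a => hD1 x a) hδ hDt
  refine ⟨h, ?_⟩
  have hxj : (WittVector.mk p x).coeff j = ⟨y.coeff (⟨j, by omega⟩ : Fin (n + 1)), hyj⟩ :=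
    dif_pos hj
  rw [← hwv, ← hxj, hh, hμ, hdδ, WithTop.coe_eq_coe]
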